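/- Let U be a normal ultrafilter on a measurable cardinal δ. Assume: (a) 2^ν = ν⁺ holds for all cardinals ν ≥ δ; (b) for every regular cardinal κ > δ⁺ that is not weakly compact, there exists a □(κ)-sequence; (c) for every singular cardinal κ > δ, there exists a □_κ-sequence. Then for every limit ordinal λ, the following are equivalent: (i) there is an unbounded subset of λ that is fresh over Ult(V,U); (ii) cof(λ) > δ and cof(λ) is not weakly compact. -/

import Mathlib

noncomputable section

open Cardinal Set

namespace MU

/-- The type of ordinals below the initial ordinal of `δ`, serving as the underlying
set of the cardinal `δ` and indexing the ultrapower. -/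
abbrev Idx (δ : Cardinal.{0}) : Type 1 := {o : Ordinal.{0} // o < δ.ord}

/-- A filter `F` is `κ`-complete (equivalently, `<κ`-closed): it is closed under
intersections of fewer than `κ` of its members. -/
def IsCComplete (κ : Cardinal.{0}) {X : Type*} (F : Filter X) : Prop :=
  ∀ (ι : Type) (t : ι → Set X), #ι < κ → (∀ j, t j ∈ F) → (⋂ j, t j) ∈ F

/-- `U` is a normal ultrafilter on the measurable cardinal `δ`: `δ` is uncountable and
`U` is a `δ`-complete nonprincipal ultrafilter on `δ` such that every function that is
regressive on a set in `U` is constant on a set in `U`. -/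
structure IsNormalUltrafilter (δ : Cardinal.{0}) (U : Ultrafilter (Idx δ)) : Prop where
  uncountable : ℵ₀ < δ
  complete : IsCComplete δ (U : Filter (Idx δ))
  nonprincipal : ∀ i : Idx δ, ({i} : Set (Idx δ)) ∉ U
  normal : ∀ f : Idx δ → Ordinal.{0}, { i : Idx δ | f i < i.1 } ∈ U →
    ∃ c : Ordinal.{0}, { i : Idx δ | f i = c } ∈ U

variable {δ : Cardinal.{0}} {U : Ultrafilter (Idx δ)}

/-- The Łoś ordering on representatives of ordinals of the ultrapower `Ult(V,U)`. -/
def ultLT (U : Ultrafilter (Idx δ)) (f g : Idx δ → Ordinal.{0}) : Prop :=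
  { i : Idx δ | f i < g i } ∈ U

theorem ultLT_wf (hU : IsNormalUltrafilter δ U) : WellFounded (ultLT U) := by
  haveI : IsIrrefl (Idx δ → Ordinal.{0}) (ultLT U) := by
    constructor
    intro f hf
    have h : ({ i : Idx δ | f i < f i } : Set (Idx δ)) = ∅ := by ext i; simp
    rw [ultLT, h] at hf
    exact Filter.empty_notMem (U : Filter (Idx δ)) hf
  haveI : IsTrans (Idx δ → Ordinal.{0}) (ultLT U) := by
    constructor
    intro f g h hfg hgh
    have hsub : ({ i : Idx δ | f i < g i } ∩ { i : Idx δ | g i < h i } : Set (Idx δ)) ⊆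
        { i : Idx δ | f i < h i } := fun i hi => show f i < h i from lt_trans hi.1 hi.2
    exact Filter.mem_of_superset (Filter.inter_mem hfg hgh) hsub
  haveI : IsStrictOrder (Idx δ → Ordinal.{0}) (ultLT U) := ⟨⟩
  rw [RelEmbedding.wellFounded_iff_isEmpty]
  constructor
  intro g
  have hmem : ∀ n : ℕ, { i : Idx δ | g (n + 1) i < g n i } ∈ U :=
    fun n => g.map_rel_iff.2 (Nat.lt_succ_self n)
  have hint : (⋂ n : ℕ, { i : Idx δ | g (n + 1) i < g n i }) ∈ U := by
    refine hU.complete ℕ _ ?_ hmem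
    rw [Cardinal.mk_nat]
    exact hU.uncountable
  obtain ⟨i, hi⟩ := Ultrafilter.nonempty_of_mem hint
  have hdesc : ∀ n : ℕ, (fun n => g n i) (n + 1) < (fun n => g n i) n :=
    fun n => Set.mem_iInter.1 hi n
  exact (RelEmbedding.wellFounded_iff_isEmpty.1 Ordinal.lt_wf).false
    (RelEmbedding.natGT (fun n => g n i) hdesc)

/-- The ordinal represented by `f` in the transitive collapse of the ultrapower
`Ult(V,U)`, i.e. the rank of `f` in the (well-founded) Łoś ordering. -/
def ordRank (hU : IsNormalUltrafilter δ U) (f : Idx δ → Ordinal.{0}) : Ordinal.{0} :=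
  sInf { o : Ordinal.{0} | Ordinal.lift.{1} o = ((ultLT_wf hU).apply f).rank }

/-- The image of an ordinal under the ultrapower embedding `j_U : V → Ult(V,U)`. -/
def jU (hU : IsNormalUltrafilter δ U) (o : Ordinal.{0}) : Ordinal.{0} :=
  ordRank hU fun _ => o

/-- The set of ordinals that is the transitive collapse of the element of the
ultrapower `Ult(V,U)` represented by the function `f`. -/
def ultSet (hU : IsNormalUltrafilter δ U) (f : Idx δ → Set Ordinal.{0}) :
    Set Ordinal.{0} :=
  { o : Ordinal.{0} |
    ∃ g : Idx δ → Ordinal.{0}, { i : Idx δ | g i ∈ f i } ∈ U ∧ ordRank hU g = o }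

/-- A set of ordinals is (the transitive collapse of) an element of the ultrapower
`Ult(V,U)`. -/
def InUlt (hU : IsNormalUltrafilter δ U) (A : Set Ordinal.{0}) : Prop :=
  ∃ f : Idx δ → Set Ordinal.{0}, (∀ i, BddAbove (f i)) ∧ A = ultSet hU f

/-- The least upper bound of a set of ordinals. -/
def lub (A : Set Ordinal.{0}) : Ordinal.{0} :=
  sSup ((fun o => o + 1) '' A)

/-- Hamkins: a set `A` of ordinals is fresh over `Ult(V,U)` if `A ∉ Ult(V,U)` but
`A ∩ α ∈ Ult(V,U)` for every `α < lub A`. -/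
def Fresh (hU : IsNormalUltrafilter δ U) (A : Set Ordinal.{0}) : Prop :=
  ¬ InUlt hU A ∧ ∀ α < lub A, InUlt hU (A ∩ Iio α)

/-- `A` is an unbounded subset of the ordinal `l`. -/
def UnbSub (A : Set Ordinal.{0}) (l : Ordinal.{0}) : Prop :=
  A ⊆ Iio l ∧ ∀ b < l, ∃ a ∈ A, b ≤ a

/-- `A` is a closed subset of the ordinal `l`: it contains the suprema of all of its
nonempty subsets that are bounded below `l`. -/
def ClosedIn (A : Set Ordinal.{0}) (l : Ordinal.{0}) : Prop :=
  ∀ S ⊆ A, S.Nonempty → sSup S < l → sSup S ∈ A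

/-- The set of limit points of a set of ordinals. -/
def limitPts (A : Set Ordinal.{0}) : Set Ordinal.{0} :=
  { b : Ordinal.{0} | (A ∩ Iio b).Nonempty ∧ sSup (A ∩ Iio b) = b }

/-- `S` is a stationary subset of the ordinal `l`. -/
def StationaryIn (S : Set Ordinal.{0}) (l : Ordinal.{0}) : Prop :=
  S ⊆ Iio l ∧ ∀ D : Set Ordinal.{0}, ClosedIn D l → UnbSub D l → (S ∩ D).Nonempty

/-- The order type of the set of ordinals `C` is at most `o`. -/
def otpLE (C : Set Ordinal.{0}) (o : Ordinal.{0}) : Prop :=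
  ∃ g : Ordinal.{0} → Ordinal.{0}, (∀ a ∈ C, g a < o) ∧
    ∀ a ∈ C, ∀ b ∈ C, a < b → g a < g b

/-- The order type of the set of ordinals `C` is (strictly) less than `o`. -/
def otpLT (C : Set Ordinal.{0}) (o : Ordinal.{0}) : Prop :=
  ∃ o' < o, otpLE C o'

/-- `C` is a `□(Θ)`-sequence, where `Θ` is (the initial ordinal of) an uncountable
regular cardinal. -/
structure IsSquareSeq (Θ : Ordinal.{0}) (C : Ordinal.{0} → Set Ordinal.{0}) : Prop where
  closed : ∀ γ < Θ, Order.IsSuccLimit γ → ClosedIn (C γ) γ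
  unbounded : ∀ γ < Θ, Order.IsSuccLimit γ → UnbSub (C γ) γ
  coherent : ∀ γ < Θ, Order.IsSuccLimit γ → ∀ β ∈ limitPts (C γ), β < γ → C β = C γ ∩ Iio β
  nontrivial : ¬ ∃ D : Set Ordinal.{0}, ClosedIn D Θ ∧ UnbSub D Θ ∧
    ∀ γ ∈ limitPts D, γ < Θ → D ∩ Iio γ = C γ

/-- `C` is a `□_κ`-sequence: a `□(κ⁺)`-sequence all of whose clubs have order type
at most `κ`. -/
def IsSquareKappaSeq (κ : Cardinal.{0}) (C : Ordinal.{0} → Set Ordinal.{0}) : Prop :=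
  IsSquareSeq (Order.succ κ).ord C ∧
    ∀ γ < (Order.succ κ).ord, Order.IsSuccLimit γ → otpLE (C γ) κ.ord

/-- `κ` is a weakly compact cardinal: `κ` is uncountable and every coloring of the
pairs of ordinals below `κ` in fewer than `κ` colors has a homogeneous set of size `κ`. -/
def IsWeaklyCompact (κ : Cardinal.{0}) : Prop :=
  ℵ₀ < κ ∧ ∀ (ν : Type) (c : Ordinal.{0} → Ordinal.{0} → ν), #ν < κ →
    ∃ H : Set Ordinal.{0}, H ⊆ Iio κ.ord ∧ Cardinal.lift.{1} κ ≤ #H ∧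
      ∀ a ∈ H, ∀ b ∈ H, ∀ a' ∈ H, ∀ b' ∈ H, a < b → a' < b' → c a b = c a' b'

/-- `κ` is a strongly compact cardinal: every `κ`-complete filter (on any set)
extends to a `κ`-complete ultrafilter. -/
def IsStronglyCompact (κ : Cardinal.{0}) : Prop :=
  ∀ (X : Type) (F : Filter X), IsCComplete κ F →
    ∃ G : Ultrafilter X, F ≤ (G : Filter X) ∧ IsCComplete κ (G : Filter X)

/-- `κ` is a singular cardinal. -/
def IsSingular (κ : Cardinal.{0}) : Prop :=
  ℵ₀ ≤ κ ∧ κ.ord.cof < κ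

/-- The cofinality of the ordinal `l` as computed inside the ultrapower `Ult(V,U)`
(as an ordinal, i.e. the image of the ultrapower's cofinality under the transitive
collapse). -/
def cofUlt (hU : IsNormalUltrafilter δ U) (l : Ordinal.{0}) : Ordinal.{0} :=
  sInf { c : Ordinal.{0} | ∃ f : Idx δ → Ordinal.{0},
    ordRank hU f = l ∧ ordRank hU (fun i => ((f i).cof).ord) = c }

/-- The ordinal `o` is (the transitive collapse of) a cardinal of the ultrapower
`Ult(V,U)`. -/
def CardInUlt (hU : IsNormalUltrafilter δ U) (o : Ordinal.{0}) : Prop :=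
  ∃ f : Idx δ → Ordinal.{0}, ordRank hU f = o ∧
    { i : Idx δ | ((f i).card).ord = f i } ∈ U

/-- The ordinal `o` is (the transitive collapse of) a regular cardinal of the
ultrapower `Ult(V,U)`. -/
def RegularInUlt (hU : IsNormalUltrafilter δ U) (o : Ordinal.{0}) : Prop :=
  ∃ f : Idx δ → Ordinal.{0}, ordRank hU f = o ∧
    { i : Idx δ | ((f i).card).IsRegular ∧ ((f i).card).ord = f i } ∈ U

/-- The cardinal successor of the ordinal `o` as computed inside the ultrapower
`Ult(V,U)`: the least ordinal above `o` that is a cardinal in `Ult(V,U)`. -/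
def succInUlt (hU : IsNormalUltrafilter δ U) (o : Ordinal.{0}) : Ordinal.{0} :=
  sInf { c : Ordinal.{0} | o < c ∧ CardInUlt hU c }

/-- The cardinality of a set of ordinals, as an (initial) ordinal: the least ordinal
`o` such that `s` is the image of a function defined on the ordinals below `o`. -/
def setCardOrd (s : Set Ordinal.{0}) : Ordinal.{0} :=
  sInf { o : Ordinal.{0} | ∃ g : Ordinal.{0} → Ordinal.{0}, s ⊆ g '' Iio o }

theorem small_idx (δ : Cardinal.{0}) : Small.{0} (Idx δ) :=
  inferInstanceAs (Small.{0} (Iio δ.ord))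

theorem mk_idx (δ : Cardinal.{0}) : #(Idx δ) = Cardinal.lift.{1} δ :=
  (Cardinal.mk_Iio_ordinal δ.ord).trans (by rw [Cardinal.card_ord])

theorem rank_le_of_pred_imp (hU : IsNormalUltrafilter δ U) {f g : Idx δ → Ordinal.{0}}
    (h : ∀ b, ultLT U b f → ultLT U b g) :
    ((ultLT_wf hU).apply f).rank ≤ ((ultLT_wf hU).apply g).rank := by
  rw [Acc.rank_eq]
  refine Ordinal.iSup_le fun b => ?_
  exact Order.succ_le_of_lt (Acc.rank_lt_of_rel _ (h b.1 b.2))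

theorem rank_congr (hU : IsNormalUltrafilter δ U) {f g : Idx δ → Ordinal.{0}}
    (h : ∀ᶠ i in (U : Filter (Idx δ)), f i = g i) :
    ((ultLT_wf hU).apply f).rank = ((ultLT_wf hU).apply g).rank := by
  refine le_antisymm (rank_le_of_pred_imp hU fun b hb => ?_)
    (rank_le_of_pred_imp hU fun b hb => ?_)
  · have hb : ∀ᶠ i in (U : Filter (Idx δ)), b i < f i := hb
    show ∀ᶠ i in (U : Filter (Idx δ)), b i < g i
    filter_upwards [h, hb] with i hi hbi using hi ▸ hbi
  · have hb : ∀ᶠ i in (U : Filter (Idx δ)), b i < g i := hb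
    show ∀ᶠ i in (U : Filter (Idx δ)), b i < f i
    filter_upwards [h, hb] with i hi hbi using hi ▸ hbi

theorem eventually_trichotomy (U : Ultrafilter (Idx δ)) (f g : Idx δ → Ordinal.{0}) :
    (∀ᶠ i in (U : Filter (Idx δ)), f i < g i) ∨ (∀ᶠ i in (U : Filter (Idx δ)), f i = g i) ∨
      ∀ᶠ i in (U : Filter (Idx δ)), g i < f i := by
  rw [← Ultrafilter.eventually_or, ← Ultrafilter.eventually_or]
  exact Filter.Eventually.of_forall fun i => lt_trichotomy _ _

theorem ultLT_of_rank_lt (hU : IsNormalUltrafilter δ U) {f g : Idx δ → Ordinal.{0}}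
    (h : ((ultLT_wf hU).apply f).rank < ((ultLT_wf hU).apply g).rank) :
    ∀ᶠ i in (U : Filter (Idx δ)), f i < g i := by
  obtain h' | h' | h' := eventually_trichotomy U f g
  · exact h'
  · exact absurd (rank_congr hU h') h.ne
  · exact absurd (Acc.rank_lt_of_rel ((ultLT_wf hU).apply f) h') h.not_gt

theorem rank_mem_range_lift (hU : IsNormalUltrafilter δ U) (f : Idx δ → Ordinal.{0}) :
    ((ultLT_wf hU).apply f).rank ∈ Set.range Ordinal.lift.{1, 0} := by
  have := small_idx δ
  have hs : Small.{0} (∀ i : Idx δ, Iic (f i)) := inferInstance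
  have key : Iio ((ultLT_wf hU).apply f).rank ⊆
      Set.range fun b : (∀ i : Idx δ, Iic (f i)) =>
        ((ultLT_wf hU).apply fun i => (b i : Ordinal)).rank := by
    intro o ho
    obtain ⟨b, hb, rfl⟩ := Acc.mem_range_rank_of_le ((ultLT_wf hU).apply f) (le_of_lt ho)
    refine ⟨fun i => ⟨min (b i) (f i), mem_Iic.2 (min_le_right _ _)⟩, ?_⟩
    refine rank_congr hU ?_
    filter_upwards [ultLT_of_rank_lt hU ho] with i hi using min_eq_left hi.le
  have hsm : Small.{0} (Iio ((ultLT_wf hU).apply f).rank) := small_subset key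
  by_contra hcon
  have hlt : ∀ a : Ordinal.{0}, Ordinal.lift.{1} a < ((ultLT_wf hU).apply f).rank := by
    intro a
    by_contra h
    exact hcon (Ordinal.mem_range_lift_of_le (not_lt.1 h))
  refine not_small_ordinal.{0, 0} (small_of_injective (β := Iio ((ultLT_wf hU).apply f).rank)
    (f := fun a => ⟨Ordinal.lift.{1} a, hlt a⟩) fun a b hab => ?_)
  exact Ordinal.lift_inj.1 (congrArg Subtype.val hab)

theorem lift_ordRank (hU : IsNormalUltrafilter δ U) (f : Idx δ → Ordinal.{0}) :
    Ordinal.lift.{1} (ordRank hU f) = ((ultLT_wf hU).apply f).rank :=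
  csInf_mem (s := { o : Ordinal.{0} | Ordinal.lift.{1} o = ((ultLT_wf hU).apply f).rank })
    (rank_mem_range_lift hU f)

theorem ordRank_lt_iff (hU : IsNormalUltrafilter δ U) {f g : Idx δ → Ordinal.{0}} :
    ordRank hU f < ordRank hU g ↔ ∀ᶠ i in (U : Filter (Idx δ)), f i < g i := by
  rw [← Ordinal.lift_lt.{1}, lift_ordRank, lift_ordRank]
  exact ⟨ultLT_of_rank_lt hU, fun h => Acc.rank_lt_of_rel ((ultLT_wf hU).apply g) h⟩

theorem ordRank_eq_iff (hU : IsNormalUltrafilter δ U) {f g : Idx δ → Ordinal.{0}} :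
    ordRank hU f = ordRank hU g ↔ ∀ᶠ i in (U : Filter (Idx δ)), f i = g i := by
  constructor
  · intro h
    obtain h' | h' | h' := eventually_trichotomy U f g
    · exact absurd h ((ordRank_lt_iff hU).2 h').ne
    · exact h'
    · exact absurd h ((ordRank_lt_iff hU).2 h').ne'
  · intro h
    apply Ordinal.lift_inj.{1}.1
    rw [lift_ordRank, lift_ordRank, rank_congr hU h]

theorem ordRank_le_iff (hU : IsNormalUltrafilter δ U) {f g : Idx δ → Ordinal.{0}} :
    ordRank hU f ≤ ordRank hU g ↔ ∀ᶠ i in (U : Filter (Idx δ)), f i ≤ g i := by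
  rw [← not_lt, ordRank_lt_iff, ← Ultrafilter.eventually_not]
  simp only [not_lt]

theorem exists_ordRank_of_le (hU : IsNormalUltrafilter δ U) {f : Idx δ → Ordinal.{0}}
    {o : Ordinal.{0}} (h : o ≤ ordRank hU f) : ∃ g, ordRank hU g = o := by
  have h1 : Ordinal.lift.{1} o ≤ ((ultLT_wf hU).apply f).rank := by
    rw [← lift_ordRank, Ordinal.lift_le]
    exact h
  obtain ⟨b, hb, e⟩ := Acc.mem_range_rank_of_le _ h1
  refine ⟨b, Ordinal.lift_inj.{1}.1 ?_⟩
  rw [lift_ordRank, ← e]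

theorem le_jU (hU : IsNormalUltrafilter δ U) (o : Ordinal.{0}) : o ≤ jU hU o := by
  have : StrictMono (jU hU) := fun a b hab =>
    (ordRank_lt_iff hU).2 (Filter.Eventually.of_forall fun _ => hab)
  exact this.le_apply

theorem exists_ordRank (hU : IsNormalUltrafilter δ U) (o : Ordinal.{0}) :
    ∃ g, ordRank hU g = o :=
  exists_ordRank_of_le hU (le_jU hU o)

/-- A representative of an ordinal of the ultrapower. -/
def rep (hU : IsNormalUltrafilter δ U) (o : Ordinal.{0}) : Idx δ → Ordinal.{0} :=
  (exists_ordRank hU o).choose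

@[simp] theorem ordRank_rep (hU : IsNormalUltrafilter δ U) (o : Ordinal.{0}) :
    ordRank hU (rep hU o) = o :=
  (exists_ordRank hU o).choose_spec

theorem rep_lt_rep (hU : IsNormalUltrafilter δ U) {a b : Ordinal.{0}} (h : a < b) :
    ∀ᶠ i in (U : Filter (Idx δ)), rep hU a i < rep hU b i := by
  rwa [← ordRank_lt_iff hU, ordRank_rep, ordRank_rep]

theorem ordRank_mem_ultSet (hU : IsNormalUltrafilter δ U) {g : Idx δ → Ordinal.{0}}
    {F : Idx δ → Set Ordinal.{0}} :
    ordRank hU g ∈ ultSet hU F ↔ ∀ᶠ i in (U : Filter (Idx δ)), g i ∈ F i := by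
  constructor
  · rintro ⟨g', hg', e⟩
    have hg' : ∀ᶠ i in (U : Filter (Idx δ)), g' i ∈ F i := hg'
    filter_upwards [hg', (ordRank_eq_iff hU).1 e] with i h1 h2 using h2 ▸ h1
  · exact fun h => ⟨g, h, rfl⟩

theorem mem_ultSet (hU : IsNormalUltrafilter δ U) {o : Ordinal.{0}}
    {F : Idx δ → Set Ordinal.{0}} :
    o ∈ ultSet hU F ↔ ∀ᶠ i in (U : Filter (Idx δ)), rep hU o i ∈ F i := by
  rw [← ordRank_mem_ultSet hU, ordRank_rep]

theorem ultSet_subset_iff (hU : IsNormalUltrafilter δ U) {F G : Idx δ → Set Ordinal.{0}} :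
    ultSet hU F ⊆ ultSet hU G ↔ ∀ᶠ i in (U : Filter (Idx δ)), F i ⊆ G i := by
  constructor
  · intro h
    by_contra hcon
    rw [← Ultrafilter.eventually_not] at hcon
    classical
    let g : Idx δ → Ordinal.{0} := fun i => if h : ∃ x ∈ F i, x ∉ G i then h.choose else 0
    have hg : ∀ᶠ i in (U : Filter (Idx δ)), g i ∈ F i ∧ g i ∉ G i := by
      filter_upwards [hcon] with i hi
      have hi : ∃ x ∈ F i, x ∉ G i := not_subset.1 hi
      simp only [g, dif_pos hi]
      exact hi.choose_spec
    have := (ordRank_mem_ultSet hU).1 (h ((ordRank_mem_ultSet hU).2 (hg.mono fun i hi => hi.1)))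
    obtain ⟨i, hi⟩ := (this.and hg).exists
    exact hi.2.2 hi.1
  · intro h o
    rw [mem_ultSet, mem_ultSet]
    intro h'
    filter_upwards [h, h'] with i h1 h2 using h1 h2

theorem ultSet_eq_iff (hU : IsNormalUltrafilter δ U) {F G : Idx δ → Set Ordinal.{0}} :
    ultSet hU F = ultSet hU G ↔ ∀ᶠ i in (U : Filter (Idx δ)), F i = G i := by
  rw [Subset.antisymm_iff, ultSet_subset_iff, ultSet_subset_iff, ← Filter.eventually_and]
  simp only [Subset.antisymm_iff]

theorem ultSet_inter_Iio (hU : IsNormalUltrafilter δ U) (F : Idx δ → Set Ordinal.{0})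
    (g : Idx δ → Ordinal.{0}) :
    ultSet hU F ∩ Iio (ordRank hU g) = ultSet hU fun i => F i ∩ Iio (g i) := by
  ext o
  rw [mem_inter_iff, mem_ultSet, mem_ultSet, mem_Iio]
  nth_rewrite 2 [← ordRank_rep hU o]
  rw [ordRank_lt_iff, ← Filter.eventually_and]
  rfl

/-- To be in the ultrapower it suffices to be a bounded set represented by a function. -/
theorem inUlt_of_eq (hU : IsNormalUltrafilter δ U) {F : Idx δ → Set Ordinal.{0}} {a : Ordinal.{0}}
    (h : ultSet hU F ⊆ Iio a) : InUlt hU (ultSet hU F) := by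
  have e := ultSet_inter_Iio hU F (rep hU a)
  rw [ordRank_rep, inter_eq_left.2 h] at e
  exact ⟨_, fun i => ⟨rep hU a i, fun x hx => le_of_lt hx.2⟩, e⟩

theorem eventually_forall_small (hU : IsNormalUltrafilter δ U) {ι : Type} (hι : #ι < δ)
    {P : ι → Idx δ → Prop} (h : ∀ j, ∀ᶠ i in (U : Filter (Idx δ)), P j i) :
    ∀ᶠ i in (U : Filter (Idx δ)), ∀ j, P j i := by
  have := hU.complete ι (fun j => {i | P j i}) hι h
  filter_upwards [this] with i hi j using mem_iInter.1 hi j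

theorem eventually_forall_Iio (hU : IsNormalUltrafilter δ U) {o : Ordinal.{0}} (ho : o < δ.ord)
    {P : Ordinal.{0} → Idx δ → Prop} (h : ∀ j < o, ∀ᶠ i in (U : Filter (Idx δ)), P j i) :
    ∀ᶠ i in (U : Filter (Idx δ)), ∀ j < o, P j i := by
  have e := eventually_forall_small hU (ι := Shrink.{0} (Iio o)) (P := fun j i =>
    P ((equivShrink (Iio o)).symm j).1 i) ?_ (fun j => h _ ((equivShrink (Iio o)).symm j).2)
  · filter_upwards [e] with i hi j hj
    have := hi (equivShrink _ ⟨j, hj⟩)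
    simpa using this
  · have h1 : Cardinal.lift.{1} #(Shrink.{0} (Iio o)) = Cardinal.lift.{1} o.card := by
      rw [← Cardinal.mk_Iio_ordinal]
      simp
    rw [Cardinal.lift_inj.1 h1]
    exact Cardinal.lt_ord.1 ho

theorem eventually_lt_idx (hU : IsNormalUltrafilter δ U) (j : Idx δ) :
    ∀ᶠ i in (U : Filter (Idx δ)), j < i := by
  have h0 : ∀ k : Idx δ, ∀ᶠ i in (U : Filter (Idx δ)), i ≠ k := by
    intro k
    rw [Ultrafilter.eventually_not]
    exact hU.nonprincipal k
  have hlim : Order.IsSuccLimit δ.ord := Cardinal.isSuccLimit_ord hU.uncountable.le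
  have := eventually_forall_Iio hU (o := j.1 + 1) (P := fun k i => i.1 ≠ k)
    (by simpa using hlim.succ_lt j.2) (fun k hk => by
      filter_upwards [h0 ⟨k, lt_of_le_of_lt (Order.lt_add_one_iff.1 hk) j.2⟩] with i hi e
      exact hi (Subtype.ext e))
  filter_upwards [this] with i hi
  by_contra hcon
  exact hi i.1 (Order.lt_add_one_iff.2 (not_lt.1 hcon)) rfl

theorem eventually_diag (hU : IsNormalUltrafilter δ U) {P : Idx δ → Idx δ → Prop}
    (h : ∀ j, ∀ᶠ i in (U : Filter (Idx δ)), P j i) :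
    ∀ᶠ i in (U : Filter (Idx δ)), ∀ j < i, P j i := by
  by_contra hcon
  rw [← Ultrafilter.eventually_not] at hcon
  classical
  let g : Idx δ → Ordinal.{0} := fun i => if h : ∃ j < i, ¬ P j i then h.choose.1 else 0
  have hg : ∀ᶠ i in (U : Filter (Idx δ)), ∃ j < i, ¬ P j i ∧ g i = j.1 := by
    filter_upwards [hcon] with i hi
    push Not at hi
    refine ⟨hi.choose, hi.choose_spec.1, hi.choose_spec.2, ?_⟩
    simp only [g, dif_pos hi]
  obtain ⟨c, hc⟩ := hU.normal g (by
    show ∀ᶠ i in (U : Filter (Idx δ)), g i < i.1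
    filter_upwards [hg] with i hi
    obtain ⟨j, hj, -, e⟩ := hi
    rw [e]; exact hj)
  have hc : ∀ᶠ i in (U : Filter (Idx δ)), g i = c := hc
  obtain ⟨i, ⟨j, hj, -, e⟩, e'⟩ := (hg.and hc).exists
  obtain ⟨i', ⟨⟨j', hj', hn, f⟩, f'⟩, hP⟩ := ((hg.and hc).and (h j)).exists
  have : j' = j := Subtype.ext (by rw [← f, ← e, f', e'])
  exact hn (this ▸ hP)

theorem exists_bound_of_mk_lt_cof {ι : Type 1} {l : Ordinal.{0}}
    (h : #ι < Cardinal.lift.{1} l.cof) (f : ι → Ordinal.{0}) (hf : ∀ x, f x < l) :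
    ∃ b < l, ∀ x, f x ≤ b := by
  have hs : Small.{0} ι := by
    rw [Cardinal.small_iff_lift_mk_lt_univ]
    simp only [Cardinal.lift_id]
    exact h.trans (Cardinal.lift_lt_univ _)
  refine ⟨⨆ x, f x, Ordinal.lift_iSup_lt_of_lt_cof ?_ hf, fun x => Ordinal.le_iSup f x⟩
  rw [← Ordinal.lift_cof]
  simpa using h

theorem mk_Iio (o : Ordinal.{0}) : #(Iio o) = Cardinal.lift.{1} o.card :=
  Cardinal.mk_Iio_ordinal o

theorem exists_bound_Iio {o l : Ordinal.{0}} (h : o.card < l.cof) (f : Ordinal.{0} → Ordinal.{0})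
    (hf : ∀ x < o, f x < l) : ∃ b < l, ∀ x < o, f x ≤ b := by
  obtain ⟨b, hb, h⟩ := exists_bound_of_mk_lt_cof (ι := Iio o) (l := l)
    (by rw [mk_Iio]; exact Cardinal.lift_lt.2 h) (fun x => f x.1) (fun x => hf x.1 x.2)
  exact ⟨b, hb, fun x hx => h ⟨x, hx⟩⟩

theorem exists_bound_Idx {l : Ordinal.{0}} (h : δ < l.cof) (f : Idx δ → Ordinal.{0})
    (hf : ∀ x, f x < l) : ∃ b < l, ∀ x, f x ≤ b :=
  exists_bound_of_mk_lt_cof (by rw [mk_idx]; exact Cardinal.lift_lt.2 h) f hf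

theorem cof_le_mk {ι : Type 1} {l : Ordinal.{0}} (hl : Order.IsSuccLimit l)
    (f : ι → Ordinal.{0}) (hf : ∀ x, f x < l) (hc : ∀ b < l, ∃ x, b ≤ f x) :
    Cardinal.lift.{1} l.cof ≤ #ι := by
  by_contra hcon
  obtain ⟨b, hb, h⟩ := exists_bound_of_mk_lt_cof (not_le.1 hcon) f hf
  obtain ⟨x, hx⟩ := hc _ (hl.succ_lt hb)
  exact absurd (hx.trans (h x)) (Order.lt_succ b).not_ge

theorem cof_le_of_set {l : Ordinal.{0}} (hl : Order.IsSuccLimit l) {S : Set Ordinal.{0}}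
    {c : Cardinal.{0}} (hS : #S ≤ Cardinal.lift.{1} c)
    (f : Ordinal.{0} → Ordinal.{0}) (hf : ∀ x ∈ S, f x < l) (hc : ∀ b < l, ∃ x ∈ S, b ≤ f x) :
    l.cof ≤ c := by
  rw [← Cardinal.lift_le.{1}]
  refine (cof_le_mk hl (fun x : S => f x.1) (fun x => hf x.1 x.2) fun b hb => ?_).trans hS
  obtain ⟨x, hx, h⟩ := hc b hb
  exact ⟨⟨x, hx⟩, h⟩

theorem exists_cofinal_map (l : Ordinal.{0}) :
    ∃ φ : Ordinal.{0} → Ordinal.{0}, (∀ a < l.cof.ord, φ a < l) ∧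
      (∀ a b, a < b → b < l.cof.ord → φ a < φ b) ∧ ∀ c < l, ∃ a < l.cof.ord, c ≤ φ a := by
  obtain ⟨f, hf⟩ := Ordinal.exists_isFundamentalSeq (o := l) rfl
  classical
  refine ⟨fun a => if h : a < l.cof.ord then (f ⟨a, h⟩).1 else 0, fun a h => ?_,
    fun a b hab h => ?_,
    fun c h => ?_⟩
  · simp only [dif_pos h]
    exact (f ⟨a, h⟩).2
  · simp only [dif_pos h, dif_pos (hab.trans h)]
    exact hf.strictMono (show (⟨a, hab.trans h⟩ : Iio l.cof.ord) < ⟨b, h⟩ from hab)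
  · obtain ⟨_, ⟨a, rfl⟩, ha⟩ := hf.isCofinal_range ⟨c, h⟩
    refine ⟨a.1, a.2, ?_⟩
    have h' : a.1 < l.cof.ord := a.2
    simp only [dif_pos h']
    exact ha

theorem isRegular_cof {l : Ordinal.{0}} (hl : Order.IsSuccLimit l) : l.cof.IsRegular :=
  Cardinal.isRegular_cof hl

theorem isSuccLimit_ord {c : Cardinal.{0}} (h : ℵ₀ ≤ c) : Order.IsSuccLimit c.ord :=
  Cardinal.isSuccLimit_ord h

theorem unbounded_of_mk {κ : Cardinal.{0}} {H : Set Ordinal.{0}}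
    (h : Cardinal.lift.{1} κ ≤ #H) : ∀ b < κ.ord, ∃ a ∈ H, b ≤ a := by
  intro b hb
  by_contra! hcon
  have : #H ≤ #(Iio b) := Cardinal.mk_le_mk_of_subset hcon
  rw [mk_Iio] at this
  have h2 := Cardinal.lift_le.1 (h.trans this)
  exact absurd (Cardinal.lt_ord.1 hb) h2.not_gt

theorem lub_eq {A : Set Ordinal.{0}} {l : Ordinal.{0}} (hl : Order.IsSuccLimit l)
    (hA : UnbSub A l) : lub A = l := by
  have hb : BddAbove ((fun o : Ordinal.{0} => o + 1) '' A) := by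
    refine ⟨l, ?_⟩
    rintro _ ⟨a, ha, rfl⟩
    exact le_of_lt (hl.succ_lt (hA.1 ha))
  refine le_antisymm ?_ ?_
  · refine csSup_le' ?_
    rintro _ ⟨a, ha, rfl⟩
    exact le_of_lt (hl.succ_lt (hA.1 ha))
  · by_contra! hcon
    obtain ⟨a, ha, h⟩ := hA.2 _ hcon
    have : a + 1 ≤ lub A := le_csSup hb ⟨a, ha, rfl⟩
    exact absurd (this.trans h) (Order.lt_succ a).not_ge

theorem InUlt.inter_Iio {hU : IsNormalUltrafilter δ U} {A : Set Ordinal.{0}} (h : InUlt hU A)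
    (a : Ordinal.{0}) : InUlt hU (A ∩ Iio a) := by
  obtain ⟨F, hF, rfl⟩ := h
  refine ⟨fun i => F i ∩ Iio (rep hU a i), fun i => (hF i).mono inter_subset_left, ?_⟩
  rw [← ultSet_inter_Iio, ordRank_rep]

theorem exists_fresh {hU : IsNormalUltrafilter δ U} {A : Set Ordinal.{0}} {l : Ordinal.{0}}
    (hl : Order.IsSuccLimit l) (hAl : A ⊆ Iio l) (hA : ¬ InUlt hU A)
    (h : ∀ b < l, ∃ a, b ≤ a ∧ InUlt hU (A ∩ Iio a)) :
    ∃ A : Set Ordinal.{0}, UnbSub A l ∧ Fresh hU A := by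
  have h' : ∀ b < l, InUlt hU (A ∩ Iio b) := by
    intro b hb
    obtain ⟨a, hba, ha⟩ := h b hb
    have := ha.inter_Iio b
    rwa [inter_assoc, Iio_inter_Iio, inf_eq_right.2 hba] at this
  have hunb : UnbSub A l := by
    refine ⟨hAl, fun b hb => ?_⟩
    by_contra! hcon
    exact hA ((inter_eq_left.2 hcon) ▸ h' b hb)
  refine ⟨A, hunb, hA, ?_⟩
  rwa [lub_eq hl hunb]

theorem inUlt_of_cof_le {hU : IsNormalUltrafilter δ U} {A : Set Ordinal.{0}} {l : Ordinal.{0}}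
    (hl : Order.IsSuccLimit l) (hAl : A ⊆ Iio l) (hc : l.cof ≤ δ)
    (h : ∀ b < l, InUlt hU (A ∩ Iio b)) : InUlt hU A := by
  obtain ⟨φ, hφl, hφm, hφc⟩ := exists_cofinal_map l
  have h2 : ∀ x : Ordinal.{0}, ∃ F : Idx δ → Set Ordinal.{0}, x < l.cof.ord →
      A ∩ Iio (φ x) = ultSet hU F := by
    intro x
    by_cases hx : x < l.cof.ord
    · obtain ⟨F, -, hF⟩ := h _ (hφl x hx)
      exact ⟨F, fun _ => hF⟩
    · exact ⟨fun _ => ∅, fun h => absurd h hx⟩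
  choose F hF using h2
  have hcδ : l.cof.ord ≤ δ.ord := Cardinal.ord_le_ord.2 hc
  have key : A = ultSet hU fun i => {y | ∃ x, x < l.cof.ord ∧ x < i.1 ∧ y ∈ F x i ∧
      y < rep hU l i} := by
    ext o
    rw [mem_ultSet]
    constructor
    · intro ho
      obtain ⟨x, hx, hox⟩ := hφc _ (hl.succ_lt (hAl ho))
      have ho' : o ∈ ultSet hU (F x) := by
        rw [← hF x hx]
        exact ⟨ho, lt_of_lt_of_le (Order.lt_succ o) hox⟩
      rw [mem_ultSet] at ho'
      filter_upwards [ho', eventually_lt_idx hU ⟨x, hx.trans_le hcδ⟩, rep_lt_rep hU (hAl ho)]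
        with i h1 h2 h3
      exact ⟨x, hx, h2, h1, h3⟩
    · intro ho
      by_contra hoA
      have h3 : ∀ j : Idx δ, ∀ᶠ i in (U : Filter (Idx δ)), j.1 < l.cof.ord →
          rep hU o i ∉ F j.1 i := by
        intro j
        by_cases hj : j.1 < l.cof.ord
        · have : o ∉ ultSet hU (F j.1) := by
            rw [← hF _ hj]
            exact fun h => hoA h.1
          rw [mem_ultSet, ← Ultrafilter.eventually_not] at this
          filter_upwards [this] with i hi _ using hi
        · exact Filter.Eventually.of_forall fun i h => absurd h hj
      obtain ⟨i, hi, x, hx, hxi, hy, -⟩ := ((eventually_diag hU h3).and ho).exists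
      exact hi ⟨x, hx.trans_le hcδ⟩ hxi hx hy
  have hb : ultSet hU (fun i => {y | ∃ x, x < l.cof.ord ∧ x < i.1 ∧ y ∈ F x i ∧
      y < rep hU l i}) ⊆ Iio l := key ▸ hAl
  rw [key]
  exact inUlt_of_eq hU hb

/-- Weakly compact cardinals are strong limits. -/
theorem IsWeaklyCompact.two_power_lt {κ δ : Cardinal.{0}} (hκ : IsWeaklyCompact κ) (h0 : ℵ₀ ≤ δ)
    (hδ : δ < κ) : (2 : Cardinal.{0}) ^ δ < κ := by
  by_contra! hcon
  classical
  let ν : Type := δ.ord.ToType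
  have hν : #ν = δ := by simp [ν]
  have hle : Cardinal.lift.{1} κ ≤ #(ULift.{1} (ν → Bool)) := by
    rw [Cardinal.mk_uLift, Cardinal.lift_le]
    simpa [hν] using hcon
  have h1 : #(Iio κ.ord) ≤ #(ULift.{1} (ν → Bool)) := by
    rw [mk_Iio, Cardinal.card_ord]
    exact hle
  obtain ⟨e⟩ := h1
  let E : Ordinal.{0} → ν → Bool := fun x =>
    if h : x < κ.ord then (e ⟨x, h⟩).down else fun _ => true
  have hE : ∀ a < κ.ord, ∀ b < κ.ord, E a = E b → a = b := by
    intro a ha b hb h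
    simp only [E, dif_pos ha, dif_pos hb] at h
    have := e.injective (ULift.down_injective h)
    exact congrArg Subtype.val this
  let c : Ordinal.{0} → Ordinal.{0} → Option ν := fun a b =>
    if h : ∃ n, E a n ≠ E b n then some (h.choose) else none
  have hc : ∀ a < κ.ord, ∀ b < κ.ord, a ≠ b → ∃ n, c a b = some n ∧ E a n ≠ E b n := by
    intro a ha b hb hab
    have : ∃ n, E a n ≠ E b n := by
      by_contra! hh
      exact hab (hE a ha b hb (funext hh))
    exact ⟨this.choose, by simp only [c, dif_pos this], this.choose_spec⟩
  obtain ⟨H, hH, hHc, hhom⟩ := hκ.2 (Option ν) c (by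
    rw [Cardinal.mk_option, hν, Cardinal.add_one_eq h0]; exact hδ)
  have hlim : Order.IsSuccLimit κ.ord := isSuccLimit_ord hκ.1.le
  have hub := unbounded_of_mk hHc
  obtain ⟨x, hx, -⟩ := hub 0 hlim.bot_lt
  obtain ⟨y, hy, hxy⟩ := hub _ (hlim.succ_lt (hH hx))
  obtain ⟨z, hz, hyz⟩ := hub _ (hlim.succ_lt (hH hy))
  rw [Order.succ_le_iff] at hxy hyz
  obtain ⟨n, hn, h1⟩ := hc x (hH hx) y (hH hy) hxy.ne
  obtain ⟨m, hm, h2⟩ := hc x (hH hx) z (hH hz) (hxy.trans hyz).ne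
  obtain ⟨k, hk, h3⟩ := hc y (hH hy) z (hH hz) hyz.ne
  have e1 := hhom x hx y hy x hx z hz hxy (hxy.trans hyz)
  have e2 := hhom x hx y hy y hy z hz hxy hyz
  rw [hn, hm, Option.some_inj] at e1
  rw [hn, hk, Option.some_inj] at e2
  subst e1 e2
  revert h1 h2 h3
  cases E x n <;> cases E y n <;> cases E z n <;> simp

theorem inUlt_of_weaklyCompact_cof {hU : IsNormalUltrafilter δ U} {A : Set Ordinal.{0}}
    {l : Ordinal.{0}} (hl : Order.IsSuccLimit l) (hAl : A ⊆ Iio l) (hδ : δ < l.cof)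
    (hwc : IsWeaklyCompact l.cof)
    (h : ∀ b < l, InUlt hU (A ∩ Iio b)) : InUlt hU A := by
  obtain ⟨φ, hφl, hφm, hφc⟩ := exists_cofinal_map l
  have hpow := hwc.two_power_lt hU.uncountable.le hδ
  have h2 : ∀ x : Ordinal.{0}, ∃ F : Idx δ → Set Ordinal.{0}, x < l.cof.ord →
      A ∩ Iio (φ x) = ultSet hU F := by
    intro x
    by_cases hx : x < l.cof.ord
    · obtain ⟨F, -, hF⟩ := h _ (hφl x hx)
      exact ⟨F, fun _ => hF⟩
    · exact ⟨fun _ => ∅, fun h => absurd h hx⟩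
  choose F hF using h2
  have := small_idx δ
  let X : Ordinal.{0} → Ordinal.{0} → Set (Idx δ) := fun x y =>
    {i | F x i = F y i ∩ Iio (rep hU (φ x) i)}
  have hX : ∀ x < l.cof.ord, ∀ y < l.cof.ord, x < y → X x y ∈ U := by
    intro x hx y hy hxy
    show ∀ᶠ i in (U : Filter (Idx δ)), F x i = F y i ∩ Iio (rep hU (φ x) i)
    rw [← ultSet_eq_iff hU, ← ultSet_inter_Iio, ordRank_rep, ← hF x hx, ← hF y hy, inter_assoc,
      Iio_inter_Iio, inf_eq_right.2 (hφm x y hxy hy).le]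
  let ν : Type := Shrink.{0} (Set (Idx δ))
  have hν : #ν = 2 ^ δ := by
    apply Cardinal.lift_injective.{1}
    simp [ν, mk_idx]
  obtain ⟨H, hH, hHc, hhom⟩ := hwc.2 ν (fun x y => equivShrink _ (X x y)) (by rw [hν]; exact hpow)
  simp only [EmbeddingLike.apply_eq_iff_eq] at hhom
  have hlim : Order.IsSuccLimit l.cof.ord := isSuccLimit_ord hwc.1.le
  have hub := unbounded_of_mk hHc
  obtain ⟨x0, hx0, -⟩ := hub 0 hlim.bot_lt
  obtain ⟨x1, hx1, hx01⟩ := hub _ (hlim.succ_lt (hH hx0))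
  rw [Order.succ_le_iff] at hx01
  have hY : ∀ x ∈ H, ∀ y ∈ H, x < y → X x y = X x0 x1 := fun x hx y hy hxy =>
    hhom x hx y hy x0 hx0 x1 hx1 hxy hx01
  have hYU := hX x0 (hH hx0) x1 (hH hx1) hx01
  have key : A = ultSet hU fun i => ⋃ x ∈ H, F x i := by
    ext o
    rw [mem_ultSet]
    constructor
    · intro ho
      obtain ⟨x, hx, hox⟩ := hφc _ (hl.succ_lt (hAl ho))
      obtain ⟨y, hy, hxy⟩ := hub _ (hlim.succ_lt hx)
      rw [Order.succ_le_iff] at hxy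
      have ho' : o ∈ ultSet hU (F y) := by
        rw [← hF y (hH hy)]
        exact ⟨ho, (lt_of_lt_of_le (Order.lt_succ o) hox).trans (hφm x y hxy (hH hy))⟩
      rw [mem_ultSet] at ho'
      filter_upwards [ho'] with i h1
      exact mem_biUnion hy h1
    · intro ho
      by_cases hol : o < l
      · obtain ⟨x, hx, hox⟩ := hφc _ (hl.succ_lt hol)
        obtain ⟨y, hy, hxy⟩ := hub _ (hlim.succ_lt hx)
        rw [Order.succ_le_iff] at hxy
        have hoy : o < φ y := (lt_of_lt_of_le (Order.lt_succ o) hox).trans (hφm x y hxy (hH hy))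
        suffices o ∈ ultSet hU (F y) by
          rw [← hF y (hH hy)] at this
          exact this.1
        rw [mem_ultSet]
        filter_upwards [ho, hYU, rep_lt_rep hU hoy] with i h1 h2 h3
        obtain ⟨z, hz, h1⟩ := mem_iUnion₂.1 h1
        obtain hzy | rfl | hyz := lt_trichotomy z y
        · have : i ∈ X z y := (hY z hz y hy hzy).symm ▸ h2
          have e : F z i = F y i ∩ Iio (rep hU (φ z) i) := this
          rw [e] at h1
          exact h1.1
        · exact h1
        · have : i ∈ X y z := (hY y hy z hz hyz).symm ▸ h2
          have e : F y i = F z i ∩ Iio (rep hU (φ y) i) := this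
          rw [e]
          exact ⟨h1, h3⟩
      · exfalso
        have hc : ∀ i, ∃ x ∈ H, (∃ x' ∈ H, rep hU o i ∈ F x' i) → rep hU o i ∈ F x i := by
          intro i
          by_cases hh : ∃ x' ∈ H, rep hU o i ∈ F x' i
          · obtain ⟨x, hx, hm⟩ := hh
            exact ⟨x, hx, fun _ => hm⟩
          · exact ⟨x0, hx0, fun h => absurd h hh⟩
        choose w hw hw' using hc
        obtain ⟨b, hb, hwb⟩ := exists_bound_Idx (l := l.cof.ord) (δ := δ)
          (by rw [Ordinal.cof_ord_cof]; exact hδ) w (fun i => hH (hw i))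
        obtain ⟨y, hy, hby⟩ := hub _ (hlim.succ_lt hb)
        rw [Order.succ_le_iff] at hby
        have : o ∈ ultSet hU (F y) := by
          rw [mem_ultSet]
          filter_upwards [ho, hYU] with i h1 h2
          have h1 := hw' i (by simpa using h1)
          have : i ∈ X (w i) y := (hY _ (hw i) y hy ((hwb i).trans_lt hby)).symm ▸ h2
          have e : F (w i) i = F y i ∩ Iio (rep hU (φ (w i)) i) := this
          rw [e] at h1
          exact h1.1
        rw [← hF y (hH hy)] at this
        exact hol (hAl this.1)
  have hb : ultSet hU (fun i => ⋃ x ∈ H, F x i) ⊆ Iio l := key ▸ hAl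
  rw [key]
  exact inUlt_of_eq hU hb

theorem cof_of_fresh {hU : IsNormalUltrafilter δ U} {A : Set Ordinal.{0}} {l : Ordinal.{0}}
    (hl : Order.IsSuccLimit l) (hA : UnbSub A l) (hf : Fresh hU A) :
    δ < l.cof ∧ ¬ IsWeaklyCompact l.cof := by
  have h : ∀ b < l, InUlt hU (A ∩ Iio b) := by
    have := hf.2
    rwa [lub_eq hl hA] at this
  have h1 : δ < l.cof := by
    by_contra! hc
    exact hf.1 (inUlt_of_cof_le hl hA.1 hc h)
  exact ⟨h1, fun hwc => hf.1 (inUlt_of_weaklyCompact_cof hl hA.1 h1 hwc h)⟩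

theorem exists_not_inUlt (hU : IsNormalUltrafilter δ U) {κ μ : Cardinal.{0}} (hδ : δ ≤ μ)
    (hμ : (2 : Cardinal.{0}) ^ μ < 2 ^ κ) {G : Idx δ → Set Ordinal.{0}}
    (hG : ∀ᶠ i in (U : Filter (Idx δ)), #(G i) ≤ Cardinal.lift.{1} μ)
    (p : Ordinal.{0} → Ordinal.{0}) (A : Set Ordinal.{0} → Set Ordinal.{0})
    (hp : ∀ b < κ.ord, p b ∈ ultSet hU G)
    (hA : ∀ x, ∀ b < κ.ord, (p b ∈ A x ↔ b ∈ x)) : ∃ x, ¬ InUlt hU (A x) := by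
  by_contra! hcon
  choose F hF hAF using hcon
  have he : ∀ i, ∃ e : Ordinal.{0} → μ.ord.ToType, #(G i) ≤ Cardinal.lift.{1} μ →
      InjOn e (G i) := by
    intro i
    have hne : Nonempty μ.ord.ToType := by
      rw [← Cardinal.mk_ne_zero_iff, Cardinal.mk_toType, Cardinal.card_ord]
      exact ((Cardinal.aleph0_pos.trans hU.uncountable).trans_le hδ).ne'
    by_cases h : #(G i) ≤ Cardinal.lift.{1} μ
    · have h' : Cardinal.lift.{0} #(G i) ≤ Cardinal.lift.{1} #μ.ord.ToType := by
        simpa using h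
      obtain ⟨e⟩ := Cardinal.lift_mk_le'.1 h'
      classical
      refine ⟨fun y => if hy : y ∈ G i then e ⟨y, hy⟩ else Classical.arbitrary _, fun _ => ?_⟩
      intro a ha b hb hab
      simp only [dif_pos ha, dif_pos hb] at hab
      exact congrArg Subtype.val (e.injective hab)
    · exact ⟨fun _ => Classical.arbitrary _, fun h' => absurd h' h⟩
  choose e he using he
  let Ψ : Set (Iio κ.ord) → Idx δ → Set μ.ord.ToType := fun X i =>
    e i '' (F (Subtype.val '' X) i ∩ G i)
  have hΨ : Function.Injective Ψ := by
    intro X Y hXY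
    have h1 : ∀ᶠ i in (U : Filter (Idx δ)), F (Subtype.val '' X) i ∩ G i =
        F (Subtype.val '' Y) i ∩ G i := by
      filter_upwards [hG] with i hi
      exact ((he i hi).image_eq_image_iff inter_subset_right inter_subset_right).1
        (congrFun hXY i)
    have h2 : ∀ b : Iio κ.ord, ∀ Z : Set (Iio κ.ord), b ∈ Z ↔
        p b.1 ∈ ultSet hU fun i => F (Subtype.val '' Z) i ∩ G i := by
      intro b Z
      have hb : b ∈ Z ↔ b.1 ∈ Subtype.val '' Z :=
        (Subtype.val_injective.mem_set_image).symm
      rw [hb, ← hA _ b.1 b.2, hAF, mem_ultSet, mem_ultSet]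
      have hG' := (mem_ultSet hU).1 (hp b.1 b.2)
      exact ⟨fun h => h.and hG', fun h => h.mono fun i hi => hi.1⟩
    ext b
    rw [h2 b X, h2 b Y, (ultSet_eq_iff hU).2 h1]
  have hle := Cardinal.mk_le_of_injective hΨ
  have h1 : #(Set (Iio κ.ord)) = Cardinal.lift.{1} (2 ^ κ) := by
    rw [Cardinal.mk_set, mk_Iio]; simp
  have h2 : #(Idx δ → Set μ.ord.ToType) = Cardinal.lift.{1} (2 ^ μ) := by
    rw [Cardinal.mk_pi, Cardinal.prod_const, Cardinal.mk_set, mk_idx, Cardinal.mk_toType,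
      Cardinal.card_ord, Cardinal.lift_id'.{0, 1}, ← Cardinal.lift_power, ← Cardinal.power_mul,
      Cardinal.mul_eq_left (hU.uncountable.le.trans hδ) hδ]
    exact (Cardinal.aleph0_pos.trans hU.uncountable).ne'
  rw [h1, h2, Cardinal.lift_le] at hle
  exact absurd hμ hle.not_gt

theorem exists_mem_le_mk_inter_Iio {S : Set Ordinal.{0}} {c : Cardinal.{1}} (h : c < #S) :
    ∃ g ∈ S, c ≤ #↥(S ∩ Iio g) := by
  have hlt : c.ord < Ordinal.type ((· < ·) : S → S → Prop) := by
    refine lt_of_lt_of_le (Cardinal.ord_lt_ord.2 h) (Cardinal.ord_le_type _)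
  let g : S := Ordinal.enum ((· < ·) : S → S → Prop) ⟨c.ord, hlt⟩
  have hg : #{y : S // y < g} = c := by
    rw [← Cardinal.card_ord c, ← Ordinal.typein_enum ((· < ·) : S → S → Prop) hlt]
    exact Ordinal.card_typein g
  refine ⟨g.1, g.2, ?_⟩
  rw [← hg]
  exact Cardinal.mk_le_of_injective (f := fun y : {y : S // y < g} =>
    (⟨y.1.1, y.1.2, y.2⟩ : ↥(S ∩ Iio g.1)))
    fun a b hab => Subtype.ext (Subtype.ext (Subtype.mk.inj hab))

theorem exists_range_superset {S : Set Ordinal.{0}} (h : #S ≤ Cardinal.lift.{1} δ) :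
    ∃ s : Idx δ → Ordinal.{0}, S ⊆ range s := by
  obtain hS | hS := S.eq_empty_or_nonempty
  · exact ⟨fun _ => 0, hS ▸ empty_subset _⟩
  rw [← mk_idx] at h
  have : Nonempty S := hS.to_subtype
  obtain ⟨e⟩ := h
  refine ⟨fun j => (Function.invFun e j).1, fun y hy => ⟨e ⟨y, hy⟩, ?_⟩⟩
  exact congrArg Subtype.val (Function.leftInverse_invFun e.injective ⟨y, hy⟩)

theorem ultSet_range (hU : IsNormalUltrafilter δ U) (s : Idx δ → Ordinal.{0}) :
    ultSet hU (fun i => {y | ∃ j < i, y = rep hU (s j) i}) = range s := by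
  ext o
  rw [mem_ultSet]
  constructor
  · intro h
    by_contra hcon
    have h3 : ∀ j : Idx δ, ∀ᶠ i in (U : Filter (Idx δ)), rep hU o i ≠ rep hU (s j) i := by
      intro j
      rw [Ultrafilter.eventually_not, ← ordRank_eq_iff hU, ordRank_rep, ordRank_rep]
      exact fun h => hcon ⟨j, h.symm⟩
    obtain ⟨i, h1, j, hj, h2⟩ := ((eventually_diag hU h3).and h).exists
    exact h1 j hj h2
  · rintro ⟨j, rfl⟩
    filter_upwards [eventually_lt_idx hU j] with i hi using ⟨j, hi, rfl⟩

theorem inUlt_of_mk_le (hU : IsNormalUltrafilter δ U) {S : Set Ordinal.{0}} {l : Ordinal.{0}}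
    (hl : S ⊆ Iio l) (h : #S ≤ Cardinal.lift.{1} δ) : InUlt hU S := by
  obtain hS | ⟨a, ha⟩ := S.eq_empty_or_nonempty
  · refine ⟨fun _ => ∅, fun _ => bddAbove_empty, ?_⟩
    rw [hS]
    refine (eq_empty_of_forall_notMem fun o ho => ?_).symm
    obtain ⟨i, hi⟩ := ((mem_ultSet hU).1 ho).exists
    exact hi
  classical
  obtain ⟨s, hs⟩ := exists_range_superset h
  have : S = range fun j => if s j ∈ S then s j else a := by
    ext o
    constructor
    · intro ho
      obtain ⟨j, rfl⟩ := hs ho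
      exact ⟨j, if_pos ho⟩
    · rintro ⟨j, rfl⟩
      show (if s j ∈ S then s j else a) ∈ S
      split_ifs with h
      exacts [h, ha]
  rw [← ultSet_range hU] at this
  rw [this] at hl ⊢
  exact inUlt_of_eq hU hl

theorem mk_le_of_small_initial (hU : IsNormalUltrafilter δ U) {F : Idx δ → Set Ordinal.{0}}
    (h : ∀ a ∈ ultSet hU F, #↥(ultSet hU F ∩ Iio a) ≤ Cardinal.lift.{1} δ) :
    ∀ᶠ i in (U : Filter (Idx δ)), #(F i) ≤ Cardinal.lift.{1} δ := by
  by_contra hcon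
  rw [← Ultrafilter.eventually_not] at hcon
  have h1 : ∀ i, ∃ g, Cardinal.lift.{1} δ < #(F i) →
      g ∈ F i ∧ Cardinal.lift.{1} δ ≤ #↥(F i ∩ Iio g) := by
    intro i
    by_cases hi : Cardinal.lift.{1} δ < #(F i)
    · obtain ⟨g, hg⟩ := exists_mem_le_mk_inter_Iio hi
      exact ⟨g, fun _ => hg⟩
    · exact ⟨0, fun h => absurd h hi⟩
  choose g hg using h1
  have hgF : ∀ᶠ i in (U : Filter (Idx δ)), g i ∈ F i ∧
      Cardinal.lift.{1} δ ≤ #↥(F i ∩ Iio (g i)) := by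
    filter_upwards [hcon] with i hi using hg i (not_le.1 hi)
  obtain ⟨s, hs⟩ := exists_range_superset
    (h (ordRank hU g) ((ordRank_mem_ultSet hU).2 (hgF.mono fun i hi => hi.1)))
  have h2 : ∀ i, ∃ y, Cardinal.lift.{1} δ ≤ #↥(F i ∩ Iio (g i)) →
      y ∈ F i ∩ Iio (g i) ∧ ∀ j < i, y ≠ rep hU (s j) i := by
    intro i
    by_cases hi : Cardinal.lift.{1} δ ≤ #↥(F i ∩ Iio (g i))
    · by_contra! hh
      have hsub : F i ∩ Iio (g i) ⊆ (fun j => rep hU (s j) i) '' Iio i := by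
        intro y hy
        obtain ⟨j, hj, e⟩ := (hh y).2 hy
        exact ⟨j, hj, e.symm⟩
      have hlt : #(Iio i) < Cardinal.lift.{1} δ := by
        have : #(Iio i) ≤ #(Iio i.1) :=
          Cardinal.mk_le_of_injective (f := fun j : Iio i => (⟨j.1.1, j.2⟩ : Iio i.1))
            fun a b hab => Subtype.ext (Subtype.ext (Subtype.mk.inj hab))
        refine this.trans_lt ?_
        rw [mk_Iio, Cardinal.lift_lt]
        exact Cardinal.lt_ord.1 i.2
      exact absurd hi (((Cardinal.mk_le_mk_of_subset hsub).trans Cardinal.mk_image_le).trans_lt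
        hlt).not_ge
    · exact ⟨0, fun h => absurd h hi⟩
  choose y hy using h2
  have hyF : ordRank hU y ∈ ultSet hU F ∩ Iio (ordRank hU g) := by
    rw [ultSet_inter_Iio, ordRank_mem_ultSet]
    filter_upwards [hgF] with i hi using (hy i hi.2).1
  obtain ⟨j, hj⟩ := hs hyF
  rw [← ordRank_rep hU (s j), ordRank_eq_iff hU] at hj
  obtain ⟨i, ⟨h1, h2⟩, h3⟩ := ((hj.and (eventually_lt_idx hU j)).and hgF).exists
  exact (hy i h3.2).2 j h2 h1.symm

theorem exists_fresh_of_cof_eq_succ {hU : IsNormalUltrafilter δ U} {l : Ordinal.{0}}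
    (hl : Order.IsSuccLimit l) (hc : l.cof = Order.succ δ)
    (ha : ∀ ν : Cardinal.{0}, δ ≤ ν → (2 : Cardinal.{0}) ^ ν = Order.succ ν) :
    ∃ A : Set Ordinal.{0}, UnbSub A l ∧ Fresh hU A := by
  obtain ⟨φ, hφl, hφm, hφc⟩ := exists_cofinal_map l
  have hmono : ∀ a < l.cof.ord, ∀ b < l.cof.ord, (φ a < φ b ↔ a < b) := by
    intro a ha b hb
    refine ⟨fun h => ?_, fun h => hφm a b h hb⟩
    by_contra! hba
    obtain rfl | hba := hba.eq_or_lt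
    · exact lt_irrefl _ h
    · exact absurd (hφm b a hba ha) h.not_gt
  let A : Set Ordinal.{0} → Set Ordinal.{0} := fun x => φ '' (x ∩ Iio l.cof.ord)
  have hAl : ∀ x, A x ⊆ Iio l := by
    rintro x _ ⟨a, ha, rfl⟩
    exact hφl a ha.2
  have hinit : ∀ x, ∀ b < l.cof.ord, #↥(A x ∩ Iio (φ b)) ≤ Cardinal.lift.{1} δ := by
    intro x b hb
    have hsub : A x ∩ Iio (φ b) ⊆ φ '' Iio b := by
      rintro _ ⟨⟨a, ha, rfl⟩, h⟩
      exact ⟨a, (hmono a ha.2 b hb).1 h, rfl⟩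
    refine ((Cardinal.mk_le_mk_of_subset hsub).trans Cardinal.mk_image_le).trans ?_
    rw [mk_Iio, Cardinal.lift_le, ← Order.lt_succ_iff, ← hc]
    exact Cardinal.lt_ord.1 hb
  suffices ∃ x, ¬ InUlt hU (A x) by
    obtain ⟨x, hx⟩ := this
    refine exists_fresh hl (hAl x) hx fun b hb => ?_
    obtain ⟨a, ha, hba⟩ := hφc b hb
    exact ⟨φ a, hba, inUlt_of_mk_le hU (l := l) (inter_subset_left.trans (hAl x)) (hinit x a ha)⟩
  by_contra! hcon
  obtain ⟨F, -, hF⟩ := hcon univ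
  have hsize := mk_le_of_small_initial hU (F := F) (by
    rw [← hF]
    rintro _ ⟨a, ha, rfl⟩
    exact hinit univ a ha.2)
  obtain ⟨x, hx⟩ := exists_not_inUlt hU (κ := l.cof) le_rfl (by
      rw [ha _ le_rfl, hc]
      exact Cardinal.cantor _) hsize φ A
    (fun b hb => by rw [← hF]; exact ⟨b, ⟨mem_univ _, hb⟩, rfl⟩) (fun x b hb => by
      constructor
      · rintro ⟨a, ha, e⟩
        have : a = b := by
          obtain h | h | h := lt_trichotomy a b
          · exact absurd e ((hmono a ha.2 b hb).2 h).ne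
          · exact h
          · exact absurd e ((hmono b hb a ha.2).2 h).ne'
        exact this ▸ ha.1
      · exact fun h => ⟨b, ⟨h, hb⟩, rfl⟩)
  exact hx (hcon x)

/-- Any two elements of `S` are related by the tree ordering with predecessor sets `T`. -/
def TreeChain (T : Ordinal.{0} → Set Ordinal.{0}) (S : Set Ordinal.{0}) : Prop :=
  ∀ x ∈ S, ∀ y ∈ S, x < y → x ∈ T y

/-- `T` is the family of predecessor sets of the tree ordering generated by the coherent
family `L` together with the additional immediate predecessors `R`, with trivial predecessor
sets outside `G`. -/
structure IsTree (L R : Ordinal.{0} → Set Ordinal.{0}) (G : Set Ordinal.{0})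
    (T : Ordinal.{0} → Set Ordinal.{0}) : Prop where
  left_lt : ∀ γ, L γ ⊆ Iio γ
  right_lt : ∀ γ, R γ ⊆ Iio γ
  coherent : ∀ γ, ∀ β ∈ L γ, L β = L γ ∩ Iio β
  mem_good : ∀ γ ∈ G, ∀ β ∈ L γ, β ∈ G
  mem_iff : ∀ γ β, β ∈ T γ ↔ γ ∈ G ∧
    ∃ x, (x ∈ L γ ∨ x ∈ R γ ∧ TreeChain T (L γ ∪ R γ)) ∧ (β = x ∨ β ∈ T x)

theorem exists_isTree {L R : Ordinal.{0} → Set Ordinal.{0}} {G : Set Ordinal.{0}}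
    (h1 : ∀ γ, L γ ⊆ Iio γ) (h2 : ∀ γ, R γ ⊆ Iio γ) (h3 : ∀ γ, ∀ β ∈ L γ, L β = L γ ∩ Iio β)
    (h4 : ∀ γ ∈ G, ∀ β ∈ L γ, β ∈ G) : ∃ T, IsTree L R G T := by
  classical
  let step : (γ : Ordinal.{0}) → (Ordinal.{0} → Set Ordinal.{0}) → Set Ordinal.{0} := fun γ T =>
    {β | γ ∈ G ∧ ∃ x, (x ∈ L γ ∨ x ∈ R γ ∧ TreeChain T (L γ ∪ R γ)) ∧ (β = x ∨ β ∈ T x)}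
  let T : Ordinal.{0} → Set Ordinal.{0} := Ordinal.lt_wf.fix fun γ ih =>
    step γ fun x => if h : x < γ then ih x h else ∅
  have hT : ∀ γ, T γ = step γ fun x => if x < γ then T x else ∅ := by
    intro γ
    simp only [T]
    rw [WellFounded.fix_eq]
    rfl
  refine ⟨T, h1, h2, h3, h4, fun γ β => ?_⟩
  have hc : TreeChain (fun x => if x < γ then T x else ∅) (L γ ∪ R γ) ↔
      TreeChain T (L γ ∪ R γ) := by
    refine forall₂_congr fun x _ => forall₂_congr fun y hy => ?_
    dsimp only
    rw [if_pos (show y < γ from union_subset (h1 γ) (h2 γ) hy)]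
  rw [hT]
  simp only [step, mem_ofPred_eq, hc]
  refine and_congr_right fun _ => exists_congr fun x => and_congr_right fun hx => ?_
  rw [if_pos]
  exact hx.elim (fun h => h1 γ h) fun h => h2 γ h.1

namespace IsTree
variable {L R : Ordinal.{0} → Set Ordinal.{0}} {G : Set Ordinal.{0}}
  {T : Ordinal.{0} → Set Ordinal.{0}}

theorem lt_of_imm (h : IsTree L R G T) {γ x : Ordinal.{0}}
    (hx : x ∈ L γ ∨ x ∈ R γ ∧ TreeChain T (L γ ∪ R γ)) : x < γ :=
  hx.elim (fun e => h.left_lt γ e) fun e => h.right_lt γ e.1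

theorem lt (h : IsTree L R G T) {γ β : Ordinal.{0}} (hβ : β ∈ T γ) : β < γ := by
  induction γ using WellFoundedLT.induction with
  | _ γ ih =>
    obtain ⟨-, x, hx, rfl | hb⟩ := (h.mem_iff γ β).1 hβ
    · exact h.lt_of_imm hx
    · exact (ih x (h.lt_of_imm hx) hb).trans (h.lt_of_imm hx)

theorem left_subset (h : IsTree L R G T) {γ : Ordinal.{0}} (hγ : γ ∈ G) : L γ ⊆ T γ :=
  fun β hβ => (h.mem_iff γ β).2 ⟨hγ, β, Or.inl hβ, Or.inl rfl⟩

theorem left_chain (h : IsTree L R G T) {γ : Ordinal.{0}} (hγ : γ ∈ G) :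
    TreeChain T (L γ) := by
  intro x hx y hy hxy
  apply h.left_subset (h.mem_good γ hγ y hy)
  rw [h.coherent γ y hy]
  exact ⟨hx, hxy⟩

theorem imm_chain (h : IsTree L R G T) {γ : Ordinal.{0}} (hγ : γ ∈ G) :
    TreeChain T {x | x ∈ L γ ∨ x ∈ R γ ∧ TreeChain T (L γ ∪ R γ)} := by
  by_cases hc : TreeChain T (L γ ∪ R γ)
  · exact fun x hx y hy hxy => hc x (hx.imp_right And.left) y (hy.imp_right And.left) hxy
  · exact fun x hx y hy hxy => h.left_chain hγ x (hx.resolve_right fun e => hc e.2)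
      y (hy.resolve_right fun e => hc e.2) hxy

theorem imm_eq_of_forall (h : IsTree L R G T) {γ : Ordinal.{0}}
    (ih : ∀ η < γ, ∀ β ∈ T η, T β = T η ∩ Iio β) (hγ : γ ∈ G) {x : Ordinal.{0}}
    (hx : x ∈ L γ ∨ x ∈ R γ ∧ TreeChain T (L γ ∪ R γ)) : T x = T γ ∩ Iio x := by
  ext α
  constructor
  · exact fun hα => ⟨(h.mem_iff γ α).2 ⟨hγ, x, hx, Or.inr hα⟩, h.lt hα⟩
  · rintro ⟨hα, hαx : α < x⟩
    obtain ⟨-, y, hy, hαy⟩ := (h.mem_iff γ α).1 hα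
    obtain hxy | rfl | hyx := lt_trichotomy x y
    · have hxy' := h.imm_chain hγ x hx y hy hxy
      obtain rfl | hαy := hαy
      · exact absurd hxy hαx.not_gt
      · rw [ih y (h.lt_of_imm hy) x hxy']
        exact ⟨hαy, hαx⟩
    · exact hαy.resolve_left hαx.ne
    · have hyx' := h.imm_chain hγ y hy x hx hyx
      obtain rfl | hαy := hαy
      · exact hyx'
      · rw [ih x (h.lt_of_imm hx) y hyx'] at hαy
        exact hαy.1

theorem eq_inter (h : IsTree L R G T) {γ β : Ordinal.{0}} (hβ : β ∈ T γ) :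
    T β = T γ ∩ Iio β := by
  induction γ using WellFoundedLT.induction generalizing β with
  | _ γ ih =>
    obtain ⟨hγ, x, hx, hb⟩ := (h.mem_iff γ β).1 hβ
    have e := h.imm_eq_of_forall (fun η hη β hβ => ih η hη hβ) hγ hx
    obtain rfl | hb := hb
    · exact e
    · rw [ih x (h.lt_of_imm hx) hb, e, inter_assoc, Iio_inter_Iio, inf_eq_right.2 (h.lt hb).le]

theorem imm_eq (h : IsTree L R G T) {γ x : Ordinal.{0}} (hγ : γ ∈ G)
    (hx : x ∈ L γ ∨ x ∈ R γ ∧ TreeChain T (L γ ∪ R γ)) : T x = T γ ∩ Iio x :=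
  h.imm_eq_of_forall (fun _ _ _ hβ => h.eq_inter hβ) hγ hx

theorem trans (h : IsTree L R G T) {γ β α : Ordinal.{0}} (hβ : β ∈ T γ) (hα : α ∈ T β) :
    α ∈ T γ := by
  rw [h.eq_inter hβ] at hα
  exact hα.1

theorem mem_of_lt (h : IsTree L R G T) {γ β α : Ordinal.{0}} (hβ : β ∈ T γ) (hα : α ∈ T γ)
    (hlt : α < β) : α ∈ T β := by
  rw [h.eq_inter hβ]
  exact ⟨hα, hlt⟩

/-- Closure of the set of nontrivial nodes under limits of branches. -/
theorem limit_mem_good (h : IsTree L R G T)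
    (hclo : ∀ γ ∈ G, ∀ ρ < γ, Order.IsSuccLimit ρ →
      (∀ β < ρ, ∃ α ∈ L γ ∪ R γ, β ≤ α ∧ α < ρ) → ρ ∈ L γ)
    {γ ρ : Ordinal.{0}} (hρ : Order.IsSuccLimit ρ) (hργ : ρ ≤ γ)
    (hc : ∀ β < ρ, ∃ α ∈ T γ, β ≤ α ∧ α < ρ) : ρ ∈ G := by
  induction γ using WellFoundedLT.induction with
  | _ γ ih =>
    obtain ⟨α, hα, -⟩ := hc 0 hρ.bot_lt
    have hγ := ((h.mem_iff γ α).1 hα).1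
    obtain rfl | hργ := hργ.eq_or_lt
    · exact hγ
    by_cases hx : ∃ x, (x ∈ L γ ∨ x ∈ R γ ∧ TreeChain T (L γ ∪ R γ)) ∧ ρ ≤ x
    · obtain ⟨x, hx, hρx⟩ := hx
      refine ih x (h.lt_of_imm hx) hρx fun β hβ => ?_
      obtain ⟨α, hα, h1, h2⟩ := hc β hβ
      refine ⟨α, ?_, h1, h2⟩
      rw [h.imm_eq hγ hx]
      exact ⟨hα, h2.trans_le hρx⟩
    · push Not at hx
      refine absurd (hx ρ (Or.inl (hclo γ hγ ρ hργ hρ fun β hβ => ?_))) (lt_irrefl _)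
      obtain ⟨α, hα, h1, -⟩ := hc β hβ
      obtain ⟨-, x, hx', hαx⟩ := (h.mem_iff γ α).1 hα
      refine ⟨x, hx'.imp_right And.left, h1.trans ?_, hx x hx'⟩
      exact hαx.elim le_of_eq fun e => (h.lt e).le

end IsTree

/-- Every function from `S` to `o` is bounded. -/
def FunBdd (o : Ordinal.{0}) (S : Set Ordinal.{0}) : Prop :=
  ∀ k : Ordinal.{0} → Ordinal.{0}, (∀ β ∈ S, k β < o) → ∃ b < o, ∀ β ∈ S, k β ≤ b

theorem FunBdd.mono {o : Ordinal.{0}} {S S' : Set Ordinal.{0}} (h : FunBdd o S) (hs : S' ⊆ S)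
    (ho : 0 < o) : FunBdd o S' := by
  classical
  intro k hk
  obtain ⟨b, hb, hkb⟩ := h (fun β => if β ∈ S' then k β else 0) (by
    intro β _
    split_ifs with hβ
    exacts [hk β hβ, ho])
  refine ⟨b, hb, fun β hβ => ?_⟩
  have := hkb β (hs hβ)
  simpa only [if_pos hβ] using this

theorem FunBdd.union {o : Ordinal.{0}} {S S' : Set Ordinal.{0}} (h : FunBdd o S)
    (h' : FunBdd o S') : FunBdd o (S ∪ S') := by
  intro k hk
  obtain ⟨b, hb, hkb⟩ := h k fun β hβ => hk β (Or.inl hβ)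
  obtain ⟨b', hb', hkb'⟩ := h' k fun β hβ => hk β (Or.inr hβ)
  refine ⟨max b b', max_lt hb hb', ?_⟩
  rintro β (hβ | hβ)
  · exact (hkb β hβ).trans (le_max_left _ _)
  · exact (hkb' β hβ).trans (le_max_right _ _)

theorem funBdd_of_mk {o : Ordinal.{0}} {S : Set Ordinal.{0}}
    (h : #S < Cardinal.lift.{1} o.cof) : FunBdd o S := by
  intro k hk
  obtain ⟨b, hb, h⟩ := exists_bound_of_mk_lt_cof h (fun x : S => k x.1) fun x => hk x.1 x.2
  exact ⟨b, hb, fun β hβ => h ⟨β, hβ⟩⟩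

theorem IsTree.funBdd {L R : Ordinal.{0} → Set Ordinal.{0}} {G : Set Ordinal.{0}}
    {T : Ordinal.{0} → Set Ordinal.{0}} (h : IsTree L R G T) {o : Ordinal.{0}} (ho : 0 < o)
    (hL : ∀ γ ∈ G, FunBdd o (L γ)) (hR : ∀ γ, FunBdd o (R γ)) (γ : Ordinal.{0}) :
    FunBdd o (T γ) := by
  induction γ using WellFoundedLT.induction with
  | _ γ ih =>
    intro k hk
    by_cases hγ : γ ∈ G
    · have hs : ∀ x, ∃ b, (x ∈ L γ ∨ x ∈ R γ ∧ TreeChain T (L γ ∪ R γ)) →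
          b < o ∧ k x ≤ b ∧ ∀ β ∈ T x, k β ≤ b := by
        intro x
        by_cases hx : x ∈ L γ ∨ x ∈ R γ ∧ TreeChain T (L γ ∪ R γ)
        · obtain ⟨b, hb, hkb⟩ := ih x (h.lt_of_imm hx) k fun β hβ =>
            hk β ((h.mem_iff γ β).2 ⟨hγ, x, hx, Or.inr hβ⟩)
          exact ⟨max (k x) b, fun _ =>
            ⟨max_lt (hk x ((h.mem_iff γ x).2 ⟨hγ, x, hx, Or.inl rfl⟩)) hb, le_max_left _ _,
              fun β hβ => (hkb β hβ).trans (le_max_right _ _)⟩⟩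
        · exact ⟨0, fun e => absurd e hx⟩
      choose b hb using hs
      have hK : FunBdd o {x | x ∈ L γ ∨ x ∈ R γ ∧ TreeChain T (L γ ∪ R γ)} :=
        ((hL γ hγ).union (hR γ)).mono (fun x hx => hx.imp_right And.left) ho
      obtain ⟨c, hc, hbc⟩ := hK b fun x hx => (hb x hx).1
      refine ⟨c, hc, fun β hβ => ?_⟩
      obtain ⟨-, x, hx, hβx⟩ := (h.mem_iff γ β).1 hβ
      refine le_trans ?_ (hbc x hx)
      obtain rfl | hβx := hβx
      · exact (hb β hx).2.1
      · exact (hb x hx).2.2 β hβx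
    · exact ⟨0, ho, fun β hβ => absurd ((h.mem_iff γ β).1 hβ).1 hγ⟩

/-- The first `i` many members of an enumeration `ξ` of candidates below `γ`. -/
def firstMembers (ξ : Ordinal.{0} → Idx δ → Ordinal.{0}) (i : Idx δ) (γ : Ordinal.{0}) :
    Set Ordinal.{0} :=
  {x | x < γ ∧ ∃ j < i, x = ξ γ j}

/-- `γ` is exhausted either by `S` or by the enumeration `x`. -/
def Covers (S : Set Ordinal.{0}) (x : Idx δ → Ordinal.{0}) (γ : Ordinal.{0}) : Prop :=
  (∀ β < γ, ∃ α ∈ S, β ≤ α) ∨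
    (∀ j, x j < γ ∧ ∀ α ∈ S, α ≤ x j) ∧ (S.Nonempty → ∃ j, x j ∈ S) ∧ ∀ β < γ, ∃ j, β ≤ x j

theorem eventually_mem_tree (hU : IsNormalUltrafilter δ U) {L : Ordinal.{0} → Set Ordinal.{0}}
    {ξ : Ordinal.{0} → Idx δ → Ordinal.{0}} {G : Idx δ → Set Ordinal.{0}}
    {T : Idx δ → Ordinal.{0} → Set Ordinal.{0}}
    (hT : ∀ i, IsTree L (firstMembers ξ i) (G i) (T i)) {Θ : Ordinal.{0}}
    (hG : ∀ γ < Θ, ∀ᶠ i in (U : Filter (Idx δ)), γ ∈ G i)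
    (hcov : ∀ γ < Θ, Covers (L γ) (ξ γ) γ) {γ : Ordinal.{0}} (hγ : γ < Θ) :
    ∀ β < γ, ∀ᶠ i in (U : Filter (Idx δ)), β ∈ T i γ := by
  induction γ using WellFoundedLT.induction with
  | _ γ ih =>
    intro β hβ
    obtain hc | ⟨hξ, hmax, hc⟩ := hcov γ hγ
    · obtain ⟨α, hα, hβα⟩ := hc β hβ
      obtain rfl | hβα := hβα.eq_or_lt
      · filter_upwards [hG γ hγ] with i hi using (hT i).left_subset hi hα
      · have hαγ := (hT (Classical.choice (by
          obtain ⟨i, -⟩ := (hG γ hγ).exists; exact ⟨i⟩))).left_lt γ hα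
        filter_upwards [hG γ hγ, ih α hαγ (lt_trans hαγ hγ) β hβα] with i hi h2
        exact (hT i).trans ((hT i).left_subset hi hα) h2
    · have hdd : ∀ᶠ i in (U : Filter (Idx δ)), ∀ j < i, ∀ k < i, ξ γ j < ξ γ k →
          ξ γ j ∈ T i (ξ γ k) := by
        refine eventually_diag hU (P := fun j i => ∀ k < i, ξ γ j < ξ γ k →
          ξ γ j ∈ T i (ξ γ k)) fun j => ?_
        refine eventually_diag hU (P := fun k i => ξ γ j < ξ γ k →
          ξ γ j ∈ T i (ξ γ k)) fun k => ?_
        by_cases hjk : ξ γ j < ξ γ k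
        · filter_upwards [ih (ξ γ k) (hξ k).1 ((hξ k).1.trans hγ) _ hjk] with i hi _ using hi
        · exact Filter.Eventually.of_forall fun i h => absurd h hjk
      have hmax' : ∃ j0, (L γ).Nonempty → ξ γ j0 ∈ L γ := by
        by_cases hne : (L γ).Nonempty
        · obtain ⟨j, hj⟩ := hmax hne
          exact ⟨j, fun _ => hj⟩
        · obtain ⟨j, -⟩ := hc β hβ
          exact ⟨j, fun e => absurd e hne⟩
      obtain ⟨j0, hj0⟩ := hmax'
      obtain ⟨j1, hj1⟩ := hc β hβ
      have hev : ∀ᶠ i in (U : Filter (Idx δ)), β = ξ γ j1 ∨ β ∈ T i (ξ γ j1) := by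
        obtain e | hlt := hj1.eq_or_lt
        · exact Filter.Eventually.of_forall fun _ => Or.inl e
        · filter_upwards [ih (ξ γ j1) (hξ j1).1 ((hξ j1).1.trans hγ) _ hlt] with i hi
            using Or.inr hi
      filter_upwards [hdd, hG γ hγ, eventually_lt_idx hU j0, eventually_lt_idx hU j1, hev]
        with i h1 hGi hi0 hi1 h2
      refine ((hT i).mem_iff γ β).2 ⟨hGi, ξ γ j1, Or.inr ⟨⟨(hξ j1).1, j1, hi1, rfl⟩, ?_⟩, h2⟩
      rintro x (hx | ⟨-, j, hj, rfl⟩) y (hy | ⟨-, k, hk, rfl⟩) hxy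
      · exact (hT i).left_chain hGi x hx y hy hxy
      · have hm := hj0 ⟨x, hx⟩
        have hxm := (hξ j0).2 x hx
        have hmk := (hξ k).2 _ hm
        have hx' : ξ γ j0 ∈ T i (ξ γ k) ∨ ξ γ j0 = ξ γ k :=
          hmk.eq_or_lt.symm.imp_left fun e => h1 j0 hi0 k hk e
        obtain rfl | hxm := hxm.eq_or_lt
        · exact hx'.resolve_right hxy.ne
        · have h3 := (hT i).left_chain hGi x hx _ hm hxm
          obtain h4 | h4 := hx'
          · exact (hT i).trans h4 h3
          · exact h4 ▸ h3
      · exact absurd ((hξ j).2 y hy) hxy.not_ge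
      · exact h1 j hj k hk hxy

/-- A family of trees on `Θ`, almost all of which contain any given relation `β < γ < Θ`,
together with functions `F γ` that are increasing along the trees and represent a cofinal
sequence of ordinals below `l`. -/
structure IsTreeSystem (hU : IsNormalUltrafilter δ U) (Θ l : Ordinal.{0})
    (L : Ordinal.{0} → Set Ordinal.{0}) (R : Idx δ → Ordinal.{0} → Set Ordinal.{0})
    (G : Idx δ → Set Ordinal.{0}) (T : Idx δ → Ordinal.{0} → Set Ordinal.{0})
    (F : Ordinal.{0} → Idx δ → Ordinal.{0}) : Prop where
  limit : Order.IsSuccLimit Θ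
  limit' : Order.IsSuccLimit l
  tree : ∀ i, IsTree L (R i) (G i) (T i)
  mono : ∀ᶠ i in (U : Filter (Idx δ)), ∀ γ < Θ, ∀ β ∈ T i γ, F β i < F γ i
  lt : ∀ γ < Θ, ordRank hU (F γ) < l
  mem : ∀ γ < Θ, ∀ β < γ, ∀ᶠ i in (U : Filter (Idx δ)), β ∈ T i γ
  cofinal : ∀ b < l, ∃ γ < Θ, b ≤ ordRank hU (F γ)

/-- The image under `F` of the predecessors of `γ` that lie in `x`. -/
def treeSet (F : Ordinal.{0} → Idx δ → Ordinal.{0}) (T : Idx δ → Ordinal.{0} → Set Ordinal.{0})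
    (x : Set Ordinal.{0}) (γ : Ordinal.{0}) (i : Idx δ) : Set Ordinal.{0} :=
  (fun β => F β i) '' (T i γ ∩ x)

/-- The union of the sets represented by the functions `treeSet F T x γ` for `γ < Θ`. -/
def branchSet (hU : IsNormalUltrafilter δ U) (Θ : Ordinal.{0})
    (F : Ordinal.{0} → Idx δ → Ordinal.{0}) (T : Idx δ → Ordinal.{0} → Set Ordinal.{0})
    (x : Set Ordinal.{0}) : Set Ordinal.{0} :=
  {o | ∃ γ < Θ, o ∈ ultSet hU (treeSet F T x γ)}

namespace IsTreeSystem
variable {hU : IsNormalUltrafilter δ U} {Θ l : Ordinal.{0}}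
  {L : Ordinal.{0} → Set Ordinal.{0}} {R : Idx δ → Ordinal.{0} → Set Ordinal.{0}}
  {G : Idx δ → Set Ordinal.{0}} {T : Idx δ → Ordinal.{0} → Set Ordinal.{0}}
  {F : Ordinal.{0} → Idx δ → Ordinal.{0}}

theorem lt_of_mem (h : IsTreeSystem hU Θ l L R G T F) {x : Set Ordinal.{0}} {γ o : Ordinal.{0}}
    (hγ : γ < Θ) (ho : o ∈ ultSet hU (treeSet F T x γ)) : o < ordRank hU (F γ) := by
  rw [← ordRank_rep hU o, ordRank_lt_iff]
  filter_upwards [h.mono, (mem_ultSet hU).1 ho] with i h1 h2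
  obtain ⟨β, hβ, e⟩ := h2
  exact e ▸ h1 γ hγ β hβ.1

theorem ultSet_treeSet_inter (h : IsTreeSystem hU Θ l L R G T F) (x : Set Ordinal.{0})
    {γ γ' : Ordinal.{0}} (hγ : γ < Θ) (hγ' : γ' < γ) :
    ultSet hU (treeSet F T x γ) ∩ Iio (ordRank hU (F γ')) = ultSet hU (treeSet F T x γ') := by
  rw [ultSet_inter_Iio, ultSet_eq_iff]
  filter_upwards [h.mono, h.mem γ hγ γ' hγ'] with i h1 h2
  ext o
  constructor
  · rintro ⟨⟨β, ⟨hβ, hx⟩, rfl⟩, hlt : F β i < F γ' i⟩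
    refine ⟨β, ⟨?_, hx⟩, rfl⟩
    obtain e | rfl | e := lt_trichotomy β γ'
    · exact (h.tree i).mem_of_lt h2 hβ e
    · exact absurd hlt (lt_irrefl _)
    · exact absurd hlt (h1 β (((h.tree i).lt hβ).trans hγ) γ'
        ((h.tree i).mem_of_lt hβ h2 e)).not_gt
  · rintro ⟨β, ⟨hβ, hx⟩, rfl⟩
    exact ⟨⟨β, ⟨(h.tree i).trans h2 hβ, hx⟩, rfl⟩, h1 γ' (hγ'.trans hγ) β hβ⟩

theorem branchSet_inter (h : IsTreeSystem hU Θ l L R G T F) (x : Set Ordinal.{0})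
    {γ : Ordinal.{0}} (hγ : γ < Θ) :
    branchSet hU Θ F T x ∩ Iio (ordRank hU (F γ)) = ultSet hU (treeSet F T x γ) := by
  ext o
  constructor
  · rintro ⟨⟨γ', hγ', ho⟩, hlt⟩
    obtain e | rfl | e := lt_trichotomy γ γ'
    · rw [← h.ultSet_treeSet_inter x hγ' e]
      exact ⟨ho, hlt⟩
    · exact ho
    · rw [← h.ultSet_treeSet_inter x hγ e] at ho
      exact ho.1
  · exact fun ho => ⟨⟨γ, hγ, ho⟩, h.lt_of_mem hγ ho⟩

theorem mem_branchSet_iff (h : IsTreeSystem hU Θ l L R G T F) (x : Set Ordinal.{0})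
    {β : Ordinal.{0}} (hβ : β < Θ) : ordRank hU (F β) ∈ branchSet hU Θ F T x ↔ β ∈ x := by
  have hs := h.limit.succ_lt hβ
  have hev := h.mem _ hs β (Order.lt_succ β)
  constructor
  · intro hm
    have hlt : ordRank hU (F β) < ordRank hU (F (Order.succ β)) := by
      rw [ordRank_lt_iff]
      filter_upwards [h.mono, hev] with i h1 h2 using h1 _ hs β h2
    have hm' : ordRank hU (F β) ∈ ultSet hU (treeSet F T x (Order.succ β)) := by
      rw [← h.branchSet_inter x hs]
      exact ⟨hm, hlt⟩
    obtain ⟨i, h1, h2, β', ⟨hβ', hx⟩, e : F β' i = F β i⟩ :=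
      (h.mono.and (hev.and ((ordRank_mem_ultSet hU).1 hm'))).exists
    obtain hl | rfl | hl := lt_trichotomy β β'
    · exact absurd e (h1 β' (((h.tree i).lt hβ').trans hs) β
        ((h.tree i).mem_of_lt hβ' h2 hl)).ne'
    · exact hx
    · exact absurd e (h1 β hβ β' ((h.tree i).mem_of_lt h2 hβ' hl)).ne
  · intro hx
    refine ⟨_, hs, (ordRank_mem_ultSet hU).2 ?_⟩
    filter_upwards [hev] with i hi using ⟨β, ⟨hi, hx⟩, rfl⟩

theorem branchSet_subset (h : IsTreeSystem hU Θ l L R G T F) (x : Set Ordinal.{0}) :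
    branchSet hU Θ F T x ⊆ Iio l := by
  rintro o ⟨γ, hγ, ho⟩
  exact (h.lt_of_mem hγ ho).trans (h.lt γ hγ)

theorem exists_fresh (h : IsTreeSystem hU Θ l L R G T F) {x : Set Ordinal.{0}}
    (hx : ¬ InUlt hU (branchSet hU Θ F T x)) :
    ∃ A : Set Ordinal.{0}, UnbSub A l ∧ Fresh hU A := by
  refine MU.exists_fresh h.limit' (h.branchSet_subset x) hx fun b hb => ?_
  obtain ⟨γ, hγ, hbγ⟩ := h.cofinal b hb
  refine ⟨_, hbγ, ?_⟩
  rw [h.branchSet_inter x hγ]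
  exact inUlt_of_eq hU fun o ho => h.lt_of_mem hγ ho

end IsTreeSystem

theorem eventually_isSuccLimit_rep (hU : IsNormalUltrafilter δ U) {l : Ordinal.{0}}
    (hl : Order.IsSuccLimit l) :
    ∀ᶠ i in (U : Filter (Idx δ)), Order.IsSuccLimit (rep hU l i) := by
  by_contra hcon
  rw [← Ultrafilter.eventually_not] at hcon
  have hp : ∀ᶠ i in (U : Filter (Idx δ)), ∃ a, rep hU l i = Order.succ a := by
    filter_upwards [hcon, rep_lt_rep hU hl.bot_lt] with i h1 h2
    by_contra! h3
    refine h1 ⟨fun h => ?_, fun a ha => h3 a ?_⟩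
    · exact absurd (h.eq_bot) (bot_le.trans_lt h2).ne'
    · exact (Order.succ_eq_of_covBy ha).symm
  have : ∃ g : Idx δ → Ordinal.{0},
      ∀ᶠ i in (U : Filter (Idx δ)), rep hU l i = Order.succ (g i) := by
    classical
    refine ⟨fun i => if h : ∃ a, rep hU l i = Order.succ a then h.choose else 0, ?_⟩
    filter_upwards [hp] with i hi
    rw [dif_pos hi]
    exact hi.choose_spec
  obtain ⟨g, hg⟩ := this
  have h1 : ordRank hU g < l := by
    rw [← ordRank_rep hU l, ordRank_lt_iff]
    filter_upwards [hg] with i hi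
    rw [hi]
    exact Order.lt_succ _
  have h2 : Order.succ (ordRank hU g) ≤ ordRank hU g := by
    nth_rewrite 1 [← ordRank_rep hU (Order.succ (ordRank hU g))]
    rw [ordRank_le_iff]
    filter_upwards [hg, rep_lt_rep hU (hl.succ_lt h1)] with i h3 h4
    rw [h3] at h4
    exact Order.lt_succ_iff.1 h4
  exact absurd h2 (Order.lt_succ _).not_ge

/-- `φ i` is an increasing cofinal map into the ordinal `λ i`. -/
def IsCofinalFamily (lam : Idx δ → Ordinal.{0}) (φ : Idx δ → Ordinal.{0} → Ordinal.{0}) : Prop :=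
  ∀ i, (∀ a < (lam i).cof.ord, φ i a < lam i) ∧
    (∀ a b, a < b → b < (lam i).cof.ord → φ i a < φ i b) ∧
    ∀ c < lam i, ∃ a < (lam i).cof.ord, c ≤ φ i a

theorem exists_isCofinalFamily (lam : Idx δ → Ordinal.{0}) : ∃ φ, IsCofinalFamily lam φ := by
  choose φ hφ using fun i => exists_cofinal_map (lam i)
  exact ⟨φ, hφ⟩

section
variable {hU : IsNormalUltrafilter δ U} {l : Ordinal.{0}} {φ : Idx δ → Ordinal.{0} → Ordinal.{0}}

theorem IsCofinalFamily.ordRank_lt (h : IsCofinalFamily (rep hU l) φ) {k : Idx δ → Ordinal.{0}}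
    (hk : ∀ᶠ i in (U : Filter (Idx δ)), k i < (rep hU l i).cof.ord) :
    ordRank hU (fun i => φ i (k i)) < l := by
  rw [← ordRank_rep hU l, ordRank_lt_iff]
  filter_upwards [hk] with i hi using (h i).1 _ hi

theorem IsCofinalFamily.exists_le (h : IsCofinalFamily (rep hU l) φ) {b : Ordinal.{0}}
    (hb : b < l) : ∃ k : Idx δ → Ordinal.{0},
      (∀ᶠ i in (U : Filter (Idx δ)), k i < (rep hU l i).cof.ord) ∧
      ∀ᶠ i in (U : Filter (Idx δ)), rep hU b i ≤ φ i (k i) := by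
  have : ∀ i, ∃ a, rep hU b i < rep hU l i → a < (rep hU l i).cof.ord ∧ rep hU b i ≤ φ i a := by
    intro i
    by_cases hi : rep hU b i < rep hU l i
    · obtain ⟨a, ha⟩ := (h i).2.2 _ hi
      exact ⟨a, fun _ => ha⟩
    · exact ⟨0, fun e => absurd e hi⟩
  choose k hk using this
  refine ⟨k, ?_, ?_⟩ <;> filter_upwards [rep_lt_rep hU hb] with i hi
  exacts [(hk i hi).1, (hk i hi).2]

theorem IsCofinalFamily.le_ordRank {k : Idx δ → Ordinal.{0}} {b : Ordinal.{0}}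
    (h : ∀ᶠ i in (U : Filter (Idx δ)), rep hU b i ≤ φ i (k i)) :
    b ≤ ordRank hU fun i => φ i (k i) := by
  nth_rewrite 1 [← ordRank_rep hU b]
  rwa [ordRank_le_iff]

theorem cof_le_two_power (hl : Order.IsSuccLimit l) {μ : Cardinal.{0}} (hδ : δ ≤ μ)
    (h : ∀ᶠ i in (U : Filter (Idx δ)), (rep hU l i).cof ≤ μ) : l.cof ≤ 2 ^ μ := by
  obtain ⟨φ, hφ⟩ := exists_isCofinalFamily (rep hU l)
  have hμ : ℵ₀ ≤ μ := hU.uncountable.le.trans hδ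
  classical
  rw [← Cardinal.lift_le.{1}]
  refine (cof_le_mk (ι := Idx δ → Iio μ.ord) hl (fun q => ordRank hU fun i => φ i
    (if (q i).1 < (rep hU l i).cof.ord then (q i).1 else 0)) (fun q => ?_) fun b hb => ?_).trans ?_
  · refine hφ.ordRank_lt (k := fun i => if (q i).1 < (rep hU l i).cof.ord then (q i).1 else 0) ?_
    filter_upwards [eventually_isSuccLimit_rep hU hl] with i hi
    split_ifs with h1
    · exact h1
    · exact Cardinal.ord_pos.2 (isRegular_cof hi).pos
  · obtain ⟨k, h1, h2⟩ := hφ.exists_le hb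
    have hμ0 : 0 < μ.ord := Cardinal.ord_pos.2 (aleph0_pos.trans_le hμ)
    let q : Idx δ → Iio μ.ord := fun i => if hi : k i < μ.ord then ⟨k i, hi⟩ else ⟨0, hμ0⟩
    have hq : ∀ i, k i < μ.ord → (q i).1 = k i := fun i hi => by simp only [q, dif_pos hi]
    refine ⟨q, IsCofinalFamily.le_ordRank
      (k := fun i => if (q i).1 < (rep hU l i).cof.ord then (q i).1 else 0) ?_⟩
    filter_upwards [h, h1, h2] with i h3 h4 h5
    rw [hq i (h4.trans_le (Cardinal.ord_le_ord.2 h3)), if_pos h4]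
    exact h5
  · rw [← Cardinal.power_def, mk_Iio, Cardinal.card_ord, mk_idx, ← Cardinal.lift_power,
      Cardinal.lift_le]
    calc μ ^ δ ≤ μ ^ μ := Cardinal.power_le_power_left (aleph0_pos.trans_le hμ).ne' hδ
      _ = 2 ^ μ := Cardinal.power_self_eq hμ

theorem IsCofinalFamily.exists_const_le (hφ : IsCofinalFamily (rep hU l) φ) {κ : Cardinal.{0}}
    (hδ : δ < κ) (hκ : κ.IsRegular) (h : ∀ᶠ i in (U : Filter (Idx δ)), (rep hU l i).cof = κ)
    {b : Ordinal.{0}} (hb : b < l) : ∃ β < κ.ord, b ≤ ordRank hU fun i => φ i β := by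
  obtain ⟨k, h1, h2⟩ := hφ.exists_le hb
  classical
  obtain ⟨β, hβ, hkβ⟩ := exists_bound_Idx (δ := δ) (l := κ.ord) (by rwa [hκ.cof_ord])
    (fun i => if k i < κ.ord then k i else 0) (fun i => by
      split_ifs with hi
      exacts [hi, Cardinal.ord_pos.2 hκ.pos])
  refine ⟨β, hβ, IsCofinalFamily.le_ordRank (k := fun _ => β) ?_⟩
  filter_upwards [h, h1, h2] with i h3 h4 h5
  rw [h3] at h4
  refine h5.trans ?_
  have h6 := hkβ i
  rw [if_pos h4] at h6
  obtain e | e := h6.eq_or_lt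
  · rw [e]
  · exact ((hφ i).2.1 _ _ e (by rwa [h3])).le

theorem cof_eq_of_eventually (hl : Order.IsSuccLimit l) {κ : Cardinal.{0}} (hδ : δ < κ)
    (h : ∀ᶠ i in (U : Filter (Idx δ)), (rep hU l i).cof = κ) : l.cof = κ := by
  have hκ : κ.IsRegular := by
    obtain ⟨i, h1, h2⟩ := (h.and (eventually_isSuccLimit_rep hU hl)).exists
    exact h1 ▸ isRegular_cof h2
  obtain ⟨φ, hφ⟩ := exists_isCofinalFamily (rep hU l)
  have hlt : ∀ β < κ.ord, ordRank hU (fun i => φ i β) < l := by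
    intro β hβ
    refine hφ.ordRank_lt (k := fun _ => β) ?_
    filter_upwards [h] with i hi
    rwa [hi]
  have hmono : ∀ β < κ.ord, ∀ α < β, ordRank hU (fun i => φ i α) < ordRank hU fun i => φ i β := by
    intro β hβ α hα
    rw [ordRank_lt_iff]
    filter_upwards [h] with i hi using (hφ i).2.1 α β hα (by rwa [hi])
  have hcof : ∀ b < l, ∃ β < κ.ord, b ≤ ordRank hU fun i => φ i β := fun b hb =>
    hφ.exists_const_le hδ hκ h hb
  refine le_antisymm ?_ ?_
  · refine cof_le_of_set hl (S := Iio κ.ord) (by rw [mk_Iio, Cardinal.card_ord])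
      (fun β => ordRank hU fun i => φ i β) hlt hcof
  · obtain ⟨ψ, h1, -, h3⟩ := exists_cofinal_map l
    choose! B hB hB' using fun a (ha : a < l.cof.ord) => hcof (ψ a) (h1 a ha)
    rw [← hκ.cof_ord]
    refine cof_le_of_set (isSuccLimit_ord hκ.aleph0_le) (S := Iio l.cof.ord)
      (by rw [mk_Iio, Cardinal.card_ord]) B hB fun b hb => ?_
    obtain ⟨a, ha, hba⟩ := h3 _ (hlt b hb)
    refine ⟨a, ha, ?_⟩
    by_contra! hcon
    exact absurd (hba.trans (hB' a ha)) (hmono b hb _ hcon).not_ge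

theorem le_cof_of_eventually (hl : Order.IsSuccLimit l) {μ : Cardinal.{0}}
    (h : ∀ μ' < μ, ∀ᶠ i in (U : Filter (Idx δ)), μ' < (rep hU l i).cof) : μ ≤ l.cof := by
  by_contra! hcon
  have hκ := h _ hcon
  obtain ⟨ψ, h1, -, h3⟩ := exists_cofinal_map l
  have hb : ∀ i, ∃ b, l.cof < (rep hU l i).cof → Order.IsSuccLimit (rep hU l i) →
      b < rep hU l i ∧ ∀ a < l.cof.ord, rep hU (ψ a) i < rep hU l i → rep hU (ψ a) i ≤ b := by
    intro i
    by_cases hi : l.cof < (rep hU l i).cof ∧ Order.IsSuccLimit (rep hU l i)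
    · classical
      obtain ⟨b, hb, hle⟩ := exists_bound_Iio (o := l.cof.ord) (l := rep hU l i)
        (by rw [Cardinal.card_ord]; exact hi.1)
        (fun a => if rep hU (ψ a) i < rep hU l i then rep hU (ψ a) i else 0) (fun a _ => by
          split_ifs with h
          exacts [h, hi.2.bot_lt])
      refine ⟨b, fun _ _ => ⟨hb, fun a ha hlt => ?_⟩⟩
      have := hle a ha
      rwa [if_pos hlt] at this
    · exact ⟨0, fun e e' => absurd ⟨e, e'⟩ hi⟩
  choose b hb using hb
  have hbl : ordRank hU b < l := by
    rw [← ordRank_rep hU l, ordRank_lt_iff]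
    filter_upwards [hκ, eventually_isSuccLimit_rep hU hl] with i h4 h5 using (hb i h4 h5).1
  obtain ⟨a, ha, hle⟩ := h3 _ (hl.succ_lt hbl)
  refine absurd hle (not_le.2 (Order.lt_succ_iff.2 ?_))
  nth_rewrite 1 [← ordRank_rep hU (ψ a)]
  rw [ordRank_le_iff]
  filter_upwards [hκ, eventually_isSuccLimit_rep hU hl, rep_lt_rep hU (h1 a ha)] with i h4 h5 h6
    using (hb i h4 h5).2 a ha h6

theorem exists_singular_limit (hl : Order.IsSuccLimit l)
    (hν : ∀ᶠ i in (U : Filter (Idx δ)), δ < (rep hU l i).cof)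
    (hne : ∀ κ, ¬ ∀ᶠ i in (U : Filter (Idx δ)), (rep hU l i).cof = κ) :
    ∃ μ : Cardinal.{0}, δ < μ ∧ IsSingular μ ∧ μ < l.cof ∧ l.cof ≤ 2 ^ μ ∧
      (∀ᶠ i in (U : Filter (Idx δ)), (rep hU l i).cof < μ) ∧
      ∀ μ' < μ, ∀ᶠ i in (U : Filter (Idx δ)), μ' < (rep hU l i).cof := by
  have hS : {μ : Cardinal.{0} | ∀ᶠ i in (U : Filter (Idx δ)), (rep hU l i).cof ≤ μ}.Nonempty := by
    have := small_idx δ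
    have hb : BddAbove (range fun i => (rep hU l i).cof) := Cardinal.bddAbove_of_small
    obtain ⟨μ, hμ⟩ := hb
    exact ⟨μ, Filter.Eventually.of_forall fun i => hμ (mem_range_self i)⟩
  obtain ⟨μ, hμ, hmin⟩ : ∃ μ : Cardinal.{0},
      (∀ᶠ i in (U : Filter (Idx δ)), (rep hU l i).cof ≤ μ) ∧
      ∀ μ' < μ, ¬ ∀ᶠ i in (U : Filter (Idx δ)), (rep hU l i).cof ≤ μ' :=
    ⟨sInf _, csInf_mem hS, fun μ' h h' => (csInf_le' (α := Cardinal.{0}) h').not_gt h⟩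
  have hlt : ∀ᶠ i in (U : Filter (Idx δ)), (rep hU l i).cof < μ := by
    have := Ultrafilter.eventually_not.2 (hne μ)
    filter_upwards [hμ, this] with i h1 h2 using lt_of_le_of_ne h1 h2
  have hgt : ∀ μ' < μ, ∀ᶠ i in (U : Filter (Idx δ)), μ' < (rep hU l i).cof := by
    intro μ' h
    filter_upwards [Ultrafilter.eventually_not.2 (hmin μ' h)] with i hi using not_le.1 hi
  have hδ : δ < μ := by
    obtain ⟨i, h1, h2⟩ := (hν.and hlt).exists
    exact h1.trans h2
  have hμ0 : ℵ₀ ≤ μ := hU.uncountable.le.trans hδ.le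
  have hsing : IsSingular μ := by
    refine ⟨hμ0, lt_of_le_of_lt ?_ hδ⟩
    rw [← Cardinal.lift_le.{1}, ← mk_idx δ]
    classical
    refine cof_le_mk (isSuccLimit_ord hμ0) (fun i => if (rep hU l i).cof < μ then
      (rep hU l i).cof.ord else 0) (fun i => ?_) fun b hb => ?_
    · split_ifs with h
      exacts [Cardinal.ord_lt_ord.2 h, Cardinal.ord_pos.2 (aleph0_pos.trans_le hμ0)]
    · obtain ⟨i, h1, h2⟩ := (hlt.and (hgt b.card (Cardinal.lt_ord.1 hb))).exists
      refine ⟨i, ?_⟩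
      rw [if_pos h1]
      exact (Cardinal.lt_ord.2 h2).le
  refine ⟨μ, hδ, hsing, lt_of_le_of_ne (le_cof_of_eventually hl hgt) ?_,
    cof_le_two_power hl hδ.le hμ, hlt, hgt⟩
  rintro rfl
  exact absurd hsing.2 (by rw [(isRegular_cof hl).cof_ord]; exact lt_irrefl _)

end

theorem mem_limitPts_iff {A : Set Ordinal.{0}} {b : Ordinal.{0}} :
    b ∈ limitPts A ↔ Order.IsSuccLimit b ∧ ∀ x < b, ∃ y ∈ A, x ≤ y ∧ y < b := by
  constructor
  · rintro ⟨hne, hs⟩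
    have h : ∀ x < b, ∃ y ∈ A, x < y ∧ y < b := by
      intro x hx
      rw [← hs] at hx
      obtain ⟨y, hy, hxy⟩ := exists_lt_of_lt_csSup hne hx
      exact ⟨y, hy.1, hxy, hy.2⟩
    refine ⟨?_, fun x hx => ?_⟩
    · obtain ⟨z, hz⟩ := hne
      refine ⟨fun hb => ?_, fun x hx => ?_⟩
      · exact absurd hb.eq_bot (bot_le.trans_lt hz.2).ne'
      · obtain ⟨y, -, h1, h2⟩ := h x hx.lt
        exact hx.2 h1 h2
    · obtain ⟨y, hy, h1, h2⟩ := h x hx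
      exact ⟨y, hy, h1.le, h2⟩
  · rintro ⟨hb, h⟩
    obtain ⟨y, hy, -, hyb⟩ := h 0 hb.bot_lt
    refine ⟨⟨y, hy, hyb⟩, le_antisymm (csSup_le' fun x hx => le_of_lt hx.2) ?_⟩
    refine le_of_forall_lt fun x hx => ?_
    obtain ⟨y, hy, h1, h2⟩ := h _ (hb.succ_lt hx)
    refine (Order.lt_succ x).trans_le (h1.trans (le_csSup ⟨b, fun x hx => le_of_lt hx.2⟩ ⟨hy, h2⟩))

theorem limitPts_inter_iff {A : Set Ordinal.{0}} {a b : Ordinal.{0}} (h : a ≤ b) :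
    a ∈ limitPts (A ∩ Iio b) ↔ a ∈ limitPts A := by
  rw [limitPts, limitPts, mem_ofPred_eq, mem_ofPred_eq, inter_assoc, Iio_inter_Iio,
    inf_eq_right.2 h]

/-- The predecessors of `γ` given by the limit points of `C γ` above `a`. -/
def squareLeft (C : Ordinal.{0} → Set Ordinal.{0}) (Θ a : Ordinal.{0}) (B : Set Ordinal.{0})
    (γ : Ordinal.{0}) : Set Ordinal.{0} :=
  {α | α < γ ∧ (γ ≤ a ∨
    (Order.IsSuccLimit γ ∧ γ < Θ ∧ γ ∉ B) ∧ a < α ∧ α ∈ limitPts (C γ))}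

theorem squareLeft_subset {C : Ordinal.{0} → Set Ordinal.{0}} {Θ a : Ordinal.{0}}
    {B : Set Ordinal.{0}} (γ : Ordinal.{0}) : squareLeft C Θ a B γ ⊆ Iio γ :=
  fun _ h => h.1

theorem squareLeft_coherent {C : Ordinal.{0} → Set Ordinal.{0}} {Θ a : Ordinal.{0}}
    {B : Set Ordinal.{0}}
    (hC : ∀ γ < Θ, Order.IsSuccLimit γ → ∀ β ∈ limitPts (C γ), β < γ → C β = C γ ∩ Iio β)
    (hB : ∀ γ < Θ, Order.IsSuccLimit γ → γ ∉ B → ∀ β ∈ limitPts (C γ), β < γ → β ∉ B)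
    (γ : Ordinal.{0}) : ∀ β ∈ squareLeft C Θ a B γ,
      squareLeft C Θ a B β = squareLeft C Θ a B γ ∩ Iio β := by
  rintro β ⟨hβγ, hβ⟩
  ext α
  obtain hγ | hγ := le_or_gt γ a
  · exact ⟨fun h => ⟨⟨h.1.trans hβγ, Or.inl hγ⟩, h.1⟩,
      fun h => ⟨h.2, Or.inl (hβγ.le.trans hγ)⟩⟩
  · obtain ⟨⟨h1, h2, h3⟩, h4, h5⟩ := hβ.resolve_left hγ.not_ge
    have e := hC γ h2 h1 β h5 hβγ
    constructor
    · rintro ⟨hα, h | ⟨-, h6, h7⟩⟩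
      · exact absurd h h4.not_ge
      · rw [e, limitPts_inter_iff hα.le] at h7
        exact ⟨⟨hα.trans hβγ, Or.inr ⟨⟨h1, h2, h3⟩, h6, h7⟩⟩, hα⟩
    · rintro ⟨⟨-, h⟩, hα : α < β⟩
      obtain ⟨-, h6, h7⟩ := h.resolve_left hγ.not_ge
      refine ⟨hα, Or.inr ⟨⟨(mem_limitPts_iff.1 h5).1, hβγ.trans h2, hB γ h2 h1 h3 β h5 hβγ⟩,
        h6, ?_⟩⟩
      rwa [e, limitPts_inter_iff hα.le]

/-- No limit ordinal `ρ < γ` is a limit of values of `x` below `ρ`. -/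
def NoAcc (x : Idx δ → Ordinal.{0}) (γ : Ordinal.{0}) : Prop :=
  ∀ ρ < γ, Order.IsSuccLimit ρ → ∃ β < ρ, ∀ j, β ≤ x j → ρ ≤ x j

theorem exists_strictMono_cofinal {C : Set Ordinal.{0}} {γ a : Ordinal.{0}}
    (hγ : Order.IsSuccLimit γ) (hC : UnbSub C γ) (ha : a < γ) {L : Set Ordinal.{0}}
    (hL : ∀ α, α ∈ L ↔ α < γ ∧ a < α ∧ α ∈ limitPts C)
    (hn : ¬ ∀ β < γ, ∃ α ∈ L, β ≤ α) :
    ∃ s : ℕ → Ordinal.{0}, StrictMono s ∧ (∀ n, s n < γ) ∧ (∀ β < γ, ∃ n, β ≤ s n) ∧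
      (∀ α ∈ L, α ≤ s 0) ∧ (L.Nonempty → s 0 ∈ L) := by
  push Not at hn
  obtain ⟨b, hbγ, hb⟩ := hn
  have hnext : ∀ x, ∃ y, x < γ → y ∈ C ∧ x < y ∧ y < γ := by
    intro x
    by_cases hx : x < γ
    · obtain ⟨y, hy, hxy⟩ := hC.2 _ (hγ.succ_lt hx)
      exact ⟨y, fun _ => ⟨hy, (Order.lt_succ x).trans_le hxy, hC.1 hy⟩⟩
    · exact ⟨0, fun h => absurd h hx⟩
  choose nx hnx using hnext
  obtain ⟨m, hmγ, ham, hmL, hm⟩ : ∃ m < γ, a < m ∧ (∀ α ∈ L, α ≤ m) ∧ (L.Nonempty → m ∈ L) := by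
    by_cases hne : L.Nonempty
    · have hbd : BddAbove L := ⟨b, fun x hx => (hb x hx).le⟩
      have hmγ : sSup L < γ := (csSup_le hne fun x hx => (hb x hx).le).trans_lt hbγ
      have ham : a < sSup L := by
        obtain ⟨α, hα⟩ := hne
        exact ((hL α).1 hα).2.1.trans_le (le_csSup hbd hα)
      have hlim : ∀ x < sSup L, ∃ y ∈ C, Order.succ x ≤ y ∧ y < sSup L := by
        intro x hx
        obtain ⟨α, hα, hxα⟩ := exists_lt_of_lt_csSup hne hx
        obtain ⟨h1, h2⟩ := mem_limitPts_iff.1 ((hL α).1 hα).2.2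
        obtain ⟨y, hy, h3, h4⟩ := h2 _ (h1.succ_lt hxα)
        exact ⟨y, hy, h3, h4.trans_le (le_csSup hbd hα)⟩
      refine ⟨sSup L, hmγ, ham, fun α hα => le_csSup hbd hα, fun _ => (hL _).2 ⟨hmγ, ham, ?_⟩⟩
      refine mem_limitPts_iff.2 ⟨⟨fun h => ?_, fun x hx => ?_⟩, fun x hx => ?_⟩
      · exact absurd h.eq_bot (bot_le.trans_lt ham).ne'
      · obtain ⟨y, -, h1, h2⟩ := hlim x hx.lt
        exact hx.2 ((Order.lt_succ x).trans_le h1) h2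
      · obtain ⟨y, hy, h1, h2⟩ := hlim x hx
        exact ⟨y, hy, (Order.le_succ x).trans h1, h2⟩
    · exact ⟨nx a, (hnx a ha).2.2, (hnx a ha).2.1, fun α hα => absurd ⟨α, hα⟩ hne,
        fun h => absurd h hne⟩
  let s : ℕ → Ordinal.{0} := fun n => nx^[n] m
  have hs1 : ∀ n, s (n + 1) = nx (s n) := fun n => Function.iterate_succ_apply' nx n m
  have hsγ : ∀ n, s n < γ := by
    intro n
    induction n with
    | zero => exact hmγ
    | succ n ih => rw [hs1]; exact (hnx _ ih).2.2
  have hmono : StrictMono s := strictMono_nat_of_lt_succ fun n => by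
    rw [hs1]; exact (hnx _ (hsγ n)).2.1
  refine ⟨s, hmono, hsγ, ?_, hmL, hm⟩
  by_contra! hcon
  obtain ⟨β, hβ, hsβ⟩ := hcon
  have hbd : BddAbove (range s) := ⟨β, by rintro _ ⟨n, rfl⟩; exact (hsβ n).le⟩
  have hle : ∀ n, s n < sSup (range s) := fun n =>
    (hmono n.lt_succ_self).trans_le (le_csSup hbd ⟨n + 1, rfl⟩)
  have hlim : ∀ x < sSup (range s), ∃ n, x < s n := by
    intro x hx
    obtain ⟨_, ⟨n, rfl⟩, h⟩ := exists_lt_of_lt_csSup (range_nonempty s) hx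
    exact ⟨n, h⟩
  have hmem : sSup (range s) ∈ L := by
    refine (hL _).2 ⟨?_, ham.trans (hle 0), mem_limitPts_iff.2
      ⟨⟨fun h => ?_, fun x hx => ?_⟩, fun x hx => ?_⟩⟩
    · refine lt_of_le_of_lt (csSup_le (range_nonempty s) ?_) hβ
      rintro _ ⟨n, rfl⟩
      exact (hsβ n).le
    · exact absurd h.eq_bot (bot_le.trans_lt (hle 0)).ne'
    · obtain ⟨n, hn⟩ := hlim x hx.lt
      exact hx.2 hn (hle n)
    · obtain ⟨n, hn⟩ := hlim x hx
      refine ⟨s (n + 1), ?_, hn.le.trans (hmono n.lt_succ_self).le, hle _⟩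
      rw [hs1]
      exact (hnx _ (hsγ n)).1
  exact absurd (hmL _ hmem) (hle 0).not_ge

theorem exists_enum (hδ : ℵ₀ ≤ δ) {C : Ordinal.{0} → Set Ordinal.{0}} {Θ a : Ordinal.{0}}
    {B : Set Ordinal.{0}} (hC : ∀ γ < Θ, Order.IsSuccLimit γ → UnbSub (C γ) γ) (γ : Ordinal.{0}) :
    ∃ x : Idx δ → Ordinal.{0}, NoAcc x γ ∧
      (γ < Θ → γ ∉ B → Covers (squareLeft C Θ a B γ) x γ) := by
  have hconst : NoAcc (fun _ : Idx δ => γ) γ := fun ρ hρ hl => ⟨0, hl.bot_lt, fun _ _ => hρ.le⟩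
  by_cases hcov : ∀ β < γ, ∃ α ∈ squareLeft C Θ a B γ, β ≤ α
  · exact ⟨_, hconst, fun _ _ => Or.inl hcov⟩
  by_cases hg : γ < Θ ∧ γ ∉ B
  swap
  · exact ⟨_, hconst, fun h1 h2 => absurd ⟨h1, h2⟩ hg⟩
  have haγ : a < γ := by
    by_contra! h
    exact hcov fun β hβ => ⟨β, ⟨hβ, Or.inl h⟩, le_rfl⟩
  by_cases hl : Order.IsSuccLimit γ
  · obtain ⟨s, h1, h2, h3, h4, h5⟩ := exists_strictMono_cofinal hl (hC γ hg.1 hl) haγ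
      (L := squareLeft C Θ a B γ) (fun α => by
        simp [squareLeft, hl, hg.1, hg.2, haγ.not_ge]) hcov
    have hinf : Infinite (Idx δ) := by
      rw [Cardinal.infinite_iff, mk_idx]
      simpa using hδ
    let e := Infinite.natEmbedding (Idx δ)
    have he : ∀ n, Function.invFun e (e n) = n := Function.leftInverse_invFun e.injective
    refine ⟨fun j => s (Function.invFun e j), fun ρ hρ hρl => ?_, fun _ _ => Or.inr ⟨fun j =>
      ⟨h2 _, fun α hα => (h4 α hα).trans (h1.monotone (Nat.zero_le _))⟩, fun hne =>
      ⟨e 0, by dsimp only; rw [he]; exact h5 hne⟩, fun β hβ => ?_⟩⟩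
    · have hex := h3 ρ hρ
      obtain ⟨k, hk, hkm⟩ : ∃ k, ρ ≤ s k ∧ ∀ m < k, ¬ ρ ≤ s m :=
        ⟨Nat.find hex, Nat.find_spec hex, fun m hm => Nat.find_min hex hm⟩
      rcases k with _ | k
      · exact ⟨0, hρl.bot_lt, fun j _ => hk.trans (h1.monotone (Nat.zero_le _))⟩
      · refine ⟨Order.succ (s k), hρl.succ_lt (not_le.1 (hkm k k.lt_succ_self)), fun j hj => ?_⟩
        exact hk.trans (h1.monotone (h1.lt_iff_lt.1 (Order.succ_le_iff.1 hj)))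
    · obtain ⟨n, hn⟩ := h3 β hβ
      exact ⟨e n, by dsimp only; rw [he]; exact hn⟩
  · obtain ⟨β, rfl⟩ : ∃ β, γ = Order.succ β := by
      by_contra! h3
      refine hl ⟨fun h => ?_, fun a ha => h3 a ?_⟩
      · exact absurd h.eq_bot (bot_le.trans_lt haγ).ne'
      · exact (Order.succ_eq_of_covBy ha).symm
    have hempty : ∀ α, α ∉ squareLeft C Θ a B (Order.succ β) := by
      rintro α ⟨-, h | h⟩
      · exact absurd h haγ.not_ge
      · exact hl h.1.1
    have hne : Nonempty (Idx δ) := ⟨⟨0, Cardinal.ord_pos.2 (aleph0_pos.trans_le hδ)⟩⟩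
    refine ⟨fun _ => β, fun ρ hρ hρl => ⟨0, hρl.bot_lt, fun _ _ => Order.lt_succ_iff.1 hρ⟩,
      fun _ _ => Or.inr ⟨fun j => ⟨Order.lt_succ β, fun α hα => absurd hα (hempty α)⟩,
      fun ⟨α, hα⟩ => absurd hα (hempty α), fun b hb => ?_⟩⟩
    exact ⟨hne.some, Order.lt_succ_iff.1 hb⟩

theorem squareLeft_closed {C : Ordinal.{0} → Set Ordinal.{0}} {Θ a : Ordinal.{0}}
    {B : Set Ordinal.{0}} {ξ : Ordinal.{0} → Idx δ → Ordinal.{0}} {i : Idx δ} {γ ρ : Ordinal.{0}}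
    (hξ : NoAcc (ξ γ) γ) (hργ : ρ < γ) (hρ : Order.IsSuccLimit ρ)
    (h : ∀ β < ρ, ∃ α ∈ squareLeft C Θ a B γ ∪ firstMembers ξ i γ, β ≤ α ∧ α < ρ) :
    ρ ∈ squareLeft C Θ a B γ := by
  obtain ⟨b, hb, hbρ⟩ := hξ ρ hργ hρ
  have h' : ∀ β < ρ, ∃ α ∈ squareLeft C Θ a B γ, β ≤ α ∧ α < ρ := by
    intro β hβ
    obtain ⟨α, hα | ⟨-, j, -, rfl⟩, h1, h2⟩ := h _ (max_lt hβ hb)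
    · exact ⟨α, hα, (le_max_left _ _).trans h1, h2⟩
    · exact absurd (hbρ j ((le_max_right _ _).trans h1)) h2.not_ge
  refine ⟨hργ, ?_⟩
  obtain hγ | hγ := le_or_gt γ a
  · exact Or.inl hγ
  obtain ⟨α, ⟨-, hα⟩, -, hαρ⟩ := h' 0 hρ.bot_lt
  obtain ⟨h1, h2, -⟩ := hα.resolve_left hγ.not_ge
  refine Or.inr ⟨h1, h2.trans hαρ, mem_limitPts_iff.2 ⟨hρ, fun x hx => ?_⟩⟩
  obtain ⟨α, ⟨-, hα⟩, h3, h4⟩ := h' _ (hρ.succ_lt hx)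
  obtain ⟨-, -, h5⟩ := hα.resolve_left hγ.not_ge
  obtain ⟨y, hy, h6, h7⟩ := (mem_limitPts_iff.1 h5).2 x ((Order.lt_succ x).trans_le h3)
  exact ⟨y, hy, h6, h7.trans h4⟩

theorem limitPts_subset_of_closedIn {C : Set Ordinal.{0}} {γ α : Ordinal.{0}}
    (hC : ClosedIn C γ) (hα : α ∈ limitPts C) (h : α < γ) : α ∈ C := by
  have := hC (C ∩ Iio α) inter_subset_left hα.1 (hα.2.symm ▸ h)
  rwa [hα.2] at this

theorem exists_increasing {o : Ordinal.{0}} (ho : Order.IsSuccLimit o)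
    {T : Ordinal.{0} → Set Ordinal.{0}} (hT : ∀ γ, T γ ⊆ Iio γ) (hb : ∀ γ, FunBdd o (T γ))
    {m : Ordinal.{0} → Ordinal.{0}} (hm : ∀ γ, m γ < o) :
    ∃ k : Ordinal.{0} → Ordinal.{0}, ∀ γ, k γ < o ∧ m γ ≤ k γ ∧ ∀ β ∈ T γ, k β < k γ := by
  classical
  let step : Ordinal.{0} → (Ordinal.{0} → Ordinal.{0}) → Ordinal.{0} := fun γ k =>
    if h : ∃ c, c < o ∧ m γ ≤ c ∧ ∀ β ∈ T γ, k β < c then h.choose else 0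
  let k : Ordinal.{0} → Ordinal.{0} := Ordinal.lt_wf.fix fun γ ih =>
    step γ fun x => if h : x < γ then ih x h else 0
  have hk : ∀ γ, k γ = step γ fun x => if x < γ then k x else 0 := by
    intro γ
    simp only [k]
    rw [WellFounded.fix_eq]
    rfl
  refine ⟨k, fun γ => ?_⟩
  induction γ using WellFoundedLT.induction with
  | _ γ ih =>
    obtain ⟨b, hbo, hkb⟩ := hb γ k fun β hβ => (ih β (hT γ hβ)).1
    have hex : ∃ c, c < o ∧ m γ ≤ c ∧ ∀ β ∈ T γ, (if β < γ then k β else 0) < c := by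
      refine ⟨max (m γ) (Order.succ b), max_lt (hm γ) (ho.succ_lt hbo), le_max_left _ _,
        fun β hβ => ?_⟩
      rw [if_pos (show β < γ from hT γ hβ)]
      exact (Order.lt_succ_iff.2 (hkb β hβ)).trans_le (le_max_right _ _)
    have e : k γ = hex.choose := by
      rw [hk]
      exact dif_pos hex
    rw [e]
    refine ⟨hex.choose_spec.1, hex.choose_spec.2.1, fun β hβ => ?_⟩
    have := hex.choose_spec.2.2 β hβ
    rwa [if_pos (show β < γ from hT γ hβ)] at this

/-- A club of order type at most `μ` that is too large is enumerated cofinally in `δ` steps. -/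
theorem exists_cofinal_enum {μ : Cardinal.{0}}
    {ν : Idx δ → Cardinal.{0}}
    (hreg : ∀ᶠ i in (U : Filter (Idx δ)), (ν i).IsRegular)
    (hlt : ∀ᶠ i in (U : Filter (Idx δ)), ν i < μ)
    (hgt : ∀ μ' < μ, ∀ᶠ i in (U : Filter (Idx δ)), μ' < ν i) {C : Set Ordinal.{0}}
    {γ : Ordinal.{0}} (hγ : Order.IsSuccLimit γ) (hC : UnbSub C γ) (hotp : otpLE C μ.ord)
    (hbad : ¬ ∀ᶠ i in (U : Filter (Idx δ)), FunBdd (ν i).ord C) :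
    ∃ x : Idx δ → Ordinal.{0}, (∀ j, x j < γ) ∧ ∀ β < γ, ∃ j, β ≤ x j := by
  obtain ⟨g, hg, hmono⟩ := hotp
  have hunb : ∀ b < μ.ord, ∃ η ∈ C, b ≤ g η := by
    intro b hb
    by_contra! hcon
    refine hbad ?_
    have hmk : #C ≤ Cardinal.lift.{1} b.card := by
      rw [← mk_Iio]
      refine Cardinal.mk_le_of_injective (f := fun x : C => (⟨g x.1, hcon x.1 x.2⟩ : Iio b)) ?_
      rintro ⟨x, hx⟩ ⟨y, hy⟩ e
      have e : g x = g y := congrArg Subtype.val e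
      obtain h | h | h := lt_trichotomy x y
      · exact absurd e (hmono x hx y hy h).ne
      · exact Subtype.ext h
      · exact absurd e (hmono y hy x hx h).ne'
    filter_upwards [hreg, hgt b.card (Cardinal.lt_ord.1 hb)] with i h1 h2
    refine funBdd_of_mk (hmk.trans_lt ?_)
    rw [h1.cof_ord]
    exact Cardinal.lift_lt.2 h2
  obtain ⟨η0, hη0, -⟩ := hC.2 0 hγ.bot_lt
  have hx : ∀ i, ∃ η ∈ C, ν i < μ → (ν i).ord ≤ g η := by
    intro i
    by_cases hi : ν i < μ
    · obtain ⟨η, hη, h⟩ := hunb _ (Cardinal.ord_lt_ord.2 hi)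
      exact ⟨η, hη, fun _ => h⟩
    · exact ⟨η0, hη0, fun h => absurd h hi⟩
  choose x hxC hx using hx
  refine ⟨x, fun j => hC.1 (hxC j), fun β hβ => ?_⟩
  obtain ⟨c, hc, hβc⟩ := hC.2 β hβ
  obtain ⟨i, h1, h2⟩ := (hlt.and (hgt _ (Cardinal.lt_ord.1 (hg c hc)))).exists
  refine ⟨i, hβc.trans ?_⟩
  by_contra! h
  exact absurd ((Cardinal.lt_ord.2 h2).trans_le (hx i h1)) (hmono _ (hxC i) c hc h).not_gt

theorem exists_fresh_of_singular (hU : IsNormalUltrafilter δ U) {l : Ordinal.{0}}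
    (hl : Order.IsSuccLimit l) {μ : Cardinal.{0}} (hδμ : δ < μ) (hκ : l.cof = Order.succ μ)
    (hpow : (2 : Cardinal.{0}) ^ μ = Order.succ μ)
    (hlt : ∀ᶠ i in (U : Filter (Idx δ)), (rep hU l i).cof < μ)
    (hgt : ∀ μ' < μ, ∀ᶠ i in (U : Filter (Idx δ)), μ' < (rep hU l i).cof)
    {C : Ordinal.{0} → Set Ordinal.{0}} (hC : IsSquareKappaSeq μ C) :
    ∃ A : Set Ordinal.{0}, UnbSub A l ∧ Fresh hU A := by
  obtain ⟨hC, hotp⟩ := hC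
  rw [← hκ] at hC hotp
  have hlim := eventually_isSuccLimit_rep hU hl
  have hreg : ∀ᶠ i in (U : Filter (Idx δ)), (rep hU l i).cof.IsRegular := by
    filter_upwards [hlim] with i hi using isRegular_cof hi
  set ν : Idx δ → Cardinal.{0} := fun i => (rep hU l i).cof with hν
  set Θ := l.cof.ord with hΘ
  let B : Set Ordinal.{0} := {γ | γ < Θ ∧ Order.IsSuccLimit γ ∧
    ¬ ∀ᶠ i in (U : Filter (Idx δ)), FunBdd (ν i).ord (C γ)}
  let L := squareLeft C Θ 0 B
  have hpos : ∀ᶠ i in (U : Filter (Idx δ)), 0 < (ν i).ord := by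
    filter_upwards [hreg] with i hi using Cardinal.ord_pos.2 hi.pos
  have hcoh : ∀ γ, ∀ β ∈ L γ, L β = L γ ∩ Iio β := by
    refine squareLeft_coherent hC.coherent fun γ hγ hγl hγB β hβ hβγ hβB => hβB.2.2 ?_
    have : ∀ᶠ i in (U : Filter (Idx δ)), FunBdd (ν i).ord (C γ) := by
      by_contra h
      exact hγB ⟨hγ, hγl, h⟩
    filter_upwards [this, hpos] with i hi h0
    refine hi.mono ?_ h0
    rw [hC.coherent γ hγ hγl β hβ hβγ]
    exact inter_subset_left
  have hLmem : ∀ γ, ∀ α ∈ L γ, α < γ ∧ (Order.IsSuccLimit γ ∧ γ < Θ ∧ γ ∉ B) ∧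
      0 < α ∧ α ∈ limitPts (C γ) := fun γ α hα =>
    ⟨hα.1, hα.2.resolve_left fun h => absurd hα.1 (h.trans bot_le).not_gt⟩
  have hξ : ∀ γ, ∃ x : Idx δ → Ordinal.{0}, γ < Θ → Covers (L γ) x γ := by
    intro γ
    by_cases hB : γ ∈ B
    · obtain ⟨x, h1, h2⟩ := exists_cofinal_enum hreg hlt hgt hB.2.1
        (hC.unbounded γ hB.1 hB.2.1) (by
          obtain ⟨g, hg⟩ := hotp γ hB.1 hB.2.1
          exact ⟨g, hg⟩) hB.2.2
      have he : ∀ α, α ∉ L γ := fun α hα => (hLmem γ α hα).2.1.2.2 hB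
      exact ⟨x, fun _ => Or.inr ⟨fun j => ⟨h1 j, fun α hα => absurd hα (he α)⟩,
        fun ⟨α, hα⟩ => absurd hα (he α), h2⟩⟩
    · obtain ⟨x, -, hx⟩ := exists_enum (δ := δ) hU.uncountable.le (a := 0) (B := B) hC.unbounded γ
      exact ⟨x, fun h => hx h hB⟩
  choose ξ hξ using hξ
  let G : Idx δ → Set Ordinal.{0} := fun i => {γ | 0 < (ν i).ord ∧ FunBdd (ν i).ord (L γ)}
  have hT : ∀ i, ∃ T, IsTree L (firstMembers ξ i) (G i) T := fun i =>
    exists_isTree squareLeft_subset (fun γ x hx => hx.1) hcoh fun γ hγ β hβ =>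
      ⟨hγ.1, hγ.2.mono (by rw [hcoh γ β hβ]; exact inter_subset_left) hγ.1⟩
  choose T hT using hT
  have hG : ∀ γ < Θ, ∀ᶠ i in (U : Filter (Idx δ)), γ ∈ G i := by
    intro γ hγ
    by_cases hne : (L γ).Nonempty
    · obtain ⟨α, hα⟩ := hne
      obtain ⟨-, ⟨h1, h2, h3⟩, -⟩ := hLmem γ α hα
      have : ∀ᶠ i in (U : Filter (Idx δ)), FunBdd (ν i).ord (C γ) := by
        by_contra h
        exact h3 ⟨h2, h1, h⟩
      filter_upwards [this, hpos] with i hi h0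
      exact ⟨h0, hi.mono (fun β hβ => limitPts_subset_of_closedIn (hC.closed γ h2 h1)
        (hLmem γ β hβ).2.2.2 hβ.1) h0⟩
    · filter_upwards [hpos] with i h0
      exact ⟨h0, fun k _ => ⟨0, h0, fun β hβ => absurd ⟨β, hβ⟩ hne⟩⟩
  obtain ⟨φ, hφ⟩ := exists_isCofinalFamily (rep hU l)
  obtain ⟨ψ, hψ1, -, hψ3⟩ := exists_cofinal_map l
  have hm : ∀ γ, ∃ m : Idx δ → Ordinal.{0}, γ < Θ →
      (∀ᶠ i in (U : Filter (Idx δ)), m i < (ν i).ord) ∧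
      ∀ᶠ i in (U : Filter (Idx δ)), rep hU (ψ γ) i ≤ φ i (m i) := by
    intro γ
    by_cases hγ : γ < Θ
    · obtain ⟨m, hm⟩ := hφ.exists_le (hψ1 γ hγ)
      exact ⟨m, fun _ => hm⟩
    · exact ⟨fun _ => 0, fun h => absurd h hγ⟩
  choose m hm using hm
  classical
  have hk : ∀ i, ∃ k : Ordinal.{0} → Ordinal.{0}, (ν i).IsRegular → δ < ν i →
      ∀ γ, k γ < (ν i).ord ∧ (m γ i < (ν i).ord → m γ i ≤ k γ) ∧ ∀ β ∈ T i γ, k β < k γ := by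
    intro i
    by_cases hi : (ν i).IsRegular ∧ δ < ν i
    · have hlimi := isSuccLimit_ord hi.1.aleph0_le
      have hR : ∀ γ, FunBdd (ν i).ord (firstMembers ξ i γ) := by
        intro γ
        refine funBdd_of_mk ?_
        rw [hi.1.cof_ord]
        have h1 : firstMembers ξ i γ ⊆ range (ξ γ) := by
          rintro _ ⟨-, j, -, rfl⟩
          exact mem_range_self j
        refine ((Cardinal.mk_le_mk_of_subset h1).trans Cardinal.mk_range_le).trans_lt ?_
        rw [mk_idx]
        exact Cardinal.lift_lt.2 hi.2
      obtain ⟨k, hk⟩ := exists_increasing hlimi (fun γ β hβ => (hT i).lt hβ)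
        ((hT i).funBdd hlimi.bot_lt (fun γ hγ => hγ.2) hR)
        (m := fun γ => if m γ i < (ν i).ord then m γ i else 0) (fun γ => by
          split_ifs with h
          exacts [h, hlimi.bot_lt])
      refine ⟨k, fun _ _ γ => ⟨(hk γ).1, fun h => ?_, (hk γ).2.2⟩⟩
      have := (hk γ).2.1
      rwa [if_pos h] at this
    · exact ⟨fun _ => 0, fun h1 h2 => absurd ⟨h1, h2⟩ hi⟩
  choose k hk using hk
  have hδν := hgt δ hδμ
  have hsys : IsTreeSystem hU Θ l L (firstMembers ξ) G T fun γ i => φ i (k i γ) := by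
    refine ⟨isSuccLimit_ord (isRegular_cof hl).aleph0_le, hl, hT, ?_, fun γ _ => ?_,
      fun γ hγ => eventually_mem_tree hU hT hG (fun γ hγ => hξ γ hγ) hγ, fun b hb => ?_⟩
    · filter_upwards [hreg, hδν] with i h1 h2 γ _ β hβ
      exact (hφ i).2.1 _ _ ((hk i h1 h2 γ).2.2 β hβ) (hk i h1 h2 γ).1
    · refine hφ.ordRank_lt (k := fun i => k i γ) ?_
      filter_upwards [hreg, hδν] with i h1 h2 using (hk i h1 h2 γ).1
    · obtain ⟨γ, hγ, hbγ⟩ := hψ3 b hb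
      refine ⟨γ, hγ, hbγ.trans (IsCofinalFamily.le_ordRank (k := fun i => k i γ) ?_)⟩
      filter_upwards [hreg, hδν, (hm γ hγ).1, (hm γ hγ).2] with i h1 h2 h3 h4
      obtain ⟨h5, h6, -⟩ := hk i h1 h2 γ
      refine h4.trans ?_
      obtain e | e := (h6 h3).eq_or_lt
      · rw [e]
      · exact ((hφ i).2.1 _ _ e h5).le
  obtain ⟨x, hx⟩ := exists_not_inUlt hU (κ := l.cof) hδμ.le
    (by rw [hpow, hκ]; exact Cardinal.cantor _) (G := fun i => φ i '' Iio (ν i).ord) (by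
      filter_upwards [hlt] with i hi
      refine Cardinal.mk_image_le.trans ?_
      rw [mk_Iio, Cardinal.card_ord]
      exact Cardinal.lift_le.2 hi.le)
    (fun β => ordRank hU fun i => φ i (k i β)) (branchSet hU Θ (fun γ i => φ i (k i γ)) T)
    (fun b _ => by
      rw [ordRank_mem_ultSet]
      filter_upwards [hreg, hδν] with i h1 h2
      exact ⟨_, (hk i h1 h2 b).1, rfl⟩)
    fun x b hb => hsys.mem_branchSet_iff x hb
  exact hsys.exists_fresh hx

/-- The limit ordinals below `Θ` that are closed under `h`. -/
def closurePts (Θ : Ordinal.{0}) (h : Ordinal.{0} → Ordinal.{0}) : Set Ordinal.{0} :=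
  {ρ | ρ < Θ ∧ Order.IsSuccLimit ρ ∧ ∀ x < ρ, h x < ρ}

theorem closedIn_closurePts (Θ : Ordinal.{0}) (h : Ordinal.{0} → Ordinal.{0}) :
    ClosedIn (closurePts Θ h) Θ := by
  intro S hS hne hlt
  have hbd : BddAbove S := ⟨Θ, fun x hx => (hS hx).1.le⟩
  refine ⟨hlt, ⟨fun h0 => ?_, fun x hx => ?_⟩, fun x hx => ?_⟩
  · obtain ⟨ρ, hρ⟩ := hne
    exact absurd h0.eq_bot ((hS hρ).2.1.bot_lt.trans_le (le_csSup hbd hρ)).ne'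
  · obtain ⟨ρ, hρ, hxρ⟩ := exists_lt_of_lt_csSup hne hx.lt
    exact hx.2 (Order.lt_succ x) (((hS hρ).2.1.succ_lt hxρ).trans_le (le_csSup hbd hρ))
  · obtain ⟨ρ, hρ, hxρ⟩ := exists_lt_of_lt_csSup hne hx
    exact ((hS hρ).2.2 x hxρ).trans_le (le_csSup hbd hρ)

theorem unbSub_closurePts {κ : Cardinal.{0}} (hκ : κ.IsRegular) (hω : ℵ₀ < κ)
    {h : Ordinal.{0} → Ordinal.{0}} (hh : ∀ x < κ.ord, h x < κ.ord) :
    UnbSub (closurePts κ.ord h) κ.ord := by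
  have hΘ := isSuccLimit_ord hκ.aleph0_le
  refine ⟨fun ρ hρ => hρ.1, fun b hb => ?_⟩
  have hnext : ∀ y, ∃ z, y < κ.ord → z < κ.ord ∧ y < z ∧ ∀ x ≤ y, h x < z := by
    intro y
    by_cases hy : y < κ.ord
    · have hs := hΘ.succ_lt hy
      obtain ⟨c, hc, hhc⟩ := exists_bound_Iio (o := Order.succ y) (l := κ.ord)
        (by rw [hκ.cof_ord]; exact Cardinal.lt_ord.1 hs) h fun x hx => hh x (hx.trans hs)
      refine ⟨max (Order.succ y) (Order.succ c), fun _ => ⟨max_lt hs (hΘ.succ_lt hc),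
        (Order.lt_succ y).trans_le (le_max_left _ _), fun x hx => ?_⟩⟩
      exact (Order.lt_succ_iff.2 (hhc x (Order.lt_succ_iff.2 hx))).trans_le (le_max_right _ _)
    · exact ⟨0, fun e => absurd e hy⟩
  choose nx hnx using hnext
  let s : ℕ → Ordinal.{0} := fun n => nx^[n] b
  have hs1 : ∀ n, s (n + 1) = nx (s n) := fun n => Function.iterate_succ_apply' nx n b
  have hsΘ : ∀ n, s n < κ.ord := by
    intro n
    induction n with
    | zero => exact hb
    | succ n ih => rw [hs1]; exact (hnx _ ih).1
  have hss : ∀ n, s n < s (n + 1) := fun n => by rw [hs1]; exact (hnx _ (hsΘ n)).2.1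
  obtain ⟨c, hc, hsc⟩ := exists_bound_of_mk_lt_cof (ι := ULift.{1} ℕ) (l := κ.ord)
    (by rw [hκ.cof_ord]; simpa using hω) (fun n => s n.down) fun n => hsΘ _
  have hbd : BddAbove (range s) := ⟨c, by rintro _ ⟨n, rfl⟩; exact hsc ⟨n⟩⟩
  have hle : ∀ n, s n < sSup (range s) := fun n => (hss n).trans_le (le_csSup hbd ⟨n + 1, rfl⟩)
  have hlim : ∀ x < sSup (range s), ∃ n, x < s n := by
    intro x hx
    obtain ⟨_, ⟨n, rfl⟩, h⟩ := exists_lt_of_lt_csSup (range_nonempty s) hx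
    exact ⟨n, h⟩
  refine ⟨sSup (range s), ⟨lt_of_le_of_lt (csSup_le (range_nonempty s) ?_) hc,
    ⟨fun h0 => ?_, fun x hx => ?_⟩, fun x hx => ?_⟩, (hle 0).le⟩
  · rintro _ ⟨n, rfl⟩
    exact hsc ⟨n⟩
  · exact absurd h0.eq_bot (bot_le.trans_lt (hle 0)).ne'
  · obtain ⟨n, hn⟩ := hlim x hx.lt
    exact hx.2 hn (hle n)
  · obtain ⟨n, hn⟩ := hlim x hx
    refine lt_trans ?_ (hle (n + 1))
    rw [hs1]
    exact (hnx _ (hsΘ n)).2.2 x hn.le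

/-- The limit ordinals above `a` for which `ξ` is the first element of `C γ` from `a` on. -/
def squareFiber (C : Ordinal.{0} → Set Ordinal.{0}) (Θ a ξ : Ordinal.{0}) : Set Ordinal.{0} :=
  {γ | γ < Θ ∧ Order.IsSuccLimit γ ∧ a < γ ∧ sInf (C γ \ Iio a) = ξ}

theorem exists_stationary_fibers {κ : Cardinal.{0}} (hκ : κ.IsRegular) (hω : ℵ₀ < κ)
    {C : Ordinal.{0} → Set Ordinal.{0}} (hC : IsSquareSeq κ.ord C) :
    ∃ a < κ.ord, ∀ b < κ.ord, ∃ ξ < κ.ord, b ≤ ξ ∧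
      StationaryIn (squareFiber C κ.ord a ξ) κ.ord := by
  by_contra! hcon
  choose! z hzΘ hz using hcon
  have hΘ := isSuccLimit_ord hκ.aleph0_le
  have hD : ∀ a ξ, ∃ D, a < κ.ord → ξ < κ.ord → z a ≤ ξ →
      ClosedIn D κ.ord ∧ UnbSub D κ.ord ∧ ∀ γ ∈ squareFiber C κ.ord a ξ, γ ∉ D := by
    intro a ξ
    by_cases h : a < κ.ord ∧ ξ < κ.ord ∧ z a ≤ ξ
    · have := hz a h.1 ξ h.2.1 h.2.2
      by_contra! hD
      refine this ⟨fun γ hγ => hγ.1, fun D hD1 hD2 => ?_⟩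
      obtain ⟨γ, h1, h2⟩ := (hD D).2.2.2 hD1 hD2
      exact ⟨γ, h1, h2⟩
    · exact ⟨∅, fun h1 h2 h3 => absurd ⟨h1, h2, h3⟩ h⟩
  choose D hD using hD
  have hn : ∀ a ξ y, ∃ x, a < κ.ord → ξ < κ.ord → y < κ.ord →
      x < κ.ord ∧ (z a ≤ ξ → x ∈ D a ξ ∧ y ≤ x) := by
    intro a ξ y
    by_cases h : (a < κ.ord ∧ ξ < κ.ord ∧ y < κ.ord) ∧ z a ≤ ξ
    · obtain ⟨-, h2, -⟩ := hD a ξ h.1.1 h.1.2.1 h.2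
      obtain ⟨x, hx, hyx⟩ := h2.2 y h.1.2.2
      exact ⟨x, fun _ _ _ => ⟨h2.1 hx, fun _ => ⟨hx, hyx⟩⟩⟩
    · exact ⟨0, fun h1 h2 h3 => ⟨hΘ.bot_lt, fun h4 => absurd ⟨⟨h1, h2, h3⟩, h4⟩ h⟩⟩
  choose n hn using hn
  have hh : ∀ y, ∃ c, y < κ.ord → c < κ.ord ∧ z y ≤ c ∧ ∀ a ≤ y, ∀ ξ ≤ y, n a ξ y ≤ c := by
    intro y
    by_cases hy : y < κ.ord
    · have hs := hΘ.succ_lt hy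
      have hsc : (Order.succ y).card < κ.ord.cof := by
        rw [hκ.cof_ord]; exact Cardinal.lt_ord.1 hs
      have h1 : ∀ a, ∃ c, a < Order.succ y → c < κ.ord ∧ ∀ ξ < Order.succ y, n a ξ y ≤ c := by
        intro a
        by_cases ha : a < Order.succ y
        · obtain ⟨c, hc, h⟩ := exists_bound_Iio hsc (fun ξ => n a ξ y) fun ξ hξ =>
            (hn a ξ y (ha.trans hs) (hξ.trans hs) hy).1
          exact ⟨c, fun _ => ⟨hc, h⟩⟩
        · exact ⟨0, fun e => absurd e ha⟩
      choose c hc using h1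
      obtain ⟨d, hd, hcd⟩ := exists_bound_Iio hsc c fun a ha => (hc a ha).1
      refine ⟨max (z y) d, fun _ => ⟨max_lt (hzΘ y hy) hd, le_max_left _ _, fun a ha ξ hξ => ?_⟩⟩
      have ha' := Order.lt_succ_iff.2 ha
      exact ((hc a ha').2 ξ (Order.lt_succ_iff.2 hξ)).trans ((hcd a ha').trans (le_max_right _ _))
    · exact ⟨0, fun e => absurd e hy⟩
  choose h hh using hh
  set E := closurePts κ.ord h with hE
  have hEunb : UnbSub E κ.ord := unbSub_closurePts hκ hω fun x hx => (hh x hx).1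
  have hED : ∀ γ ∈ E, ∀ a < γ, ∀ ξ < γ, z a ≤ ξ → γ ∈ D a ξ := by
    rintro γ ⟨hγ, hγl, hγh⟩ a ha ξ hξ hzξ
    obtain ⟨h1, -, -⟩ := hD a ξ (ha.trans hγ) (hξ.trans hγ) hzξ
    refine limitPts_subset_of_closedIn h1 (mem_limitPts_iff.2 ⟨hγl, fun x hx => ?_⟩) hγ
    have hy : max (max a ξ) x < γ := max_lt (max_lt ha hξ) hx
    obtain ⟨h2, h3⟩ := (hn a ξ _ (ha.trans hγ) (hξ.trans hγ) (hy.trans hγ)).2 hzξ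
    refine ⟨_, h2, (le_max_right _ _).trans h3, lt_of_le_of_lt ?_ (hγh _ hy)⟩
    exact (hh _ (hy.trans hγ)).2.2 a ((le_max_left _ _).trans (le_max_left _ _)) ξ
      ((le_max_right _ _).trans (le_max_left _ _))
  have hEC : ∀ γ ∈ E, ∀ ρ ∈ E, ρ < γ → C ρ = C γ ∩ Iio ρ := by
    intro γ hγ ρ hρ hργ
    refine hC.coherent γ hγ.1 hγ.2.1 ρ (mem_limitPts_iff.2 ⟨hρ.2.1, fun a ha => ?_⟩) hργ
    have hγC := hC.unbounded γ hγ.1 hγ.2.1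
    have hne : (C γ \ Iio a).Nonempty := by
      obtain ⟨y, hy, hay⟩ := hγC.2 a (ha.trans hργ)
      exact ⟨y, hy, not_lt.2 hay⟩
    have hm := csInf_mem hne
    refine ⟨sInf (C γ \ Iio a), hm.1, not_lt.1 hm.2, ?_⟩
    by_contra! hle
    have haΘ := ha.trans hρ.1
    have hza : z a ≤ sInf (C γ \ Iio a) :=
      ((hh a haΘ).2.1.trans (hρ.2.2 a ha).le).trans hle
    have hlt : sInf (C γ \ Iio a) < γ := hγC.1 hm.1
    exact (hD a _ haΘ (hlt.trans hγ.1) hza).2.2 γ ⟨hγ.1, hγ.2.1, ha.trans hργ, rfl⟩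
      (hED γ hγ a (ha.trans hργ) _ hlt hza)
  have hlimE : ∀ b < κ.ord, ∃ ρ ∈ E, b < ρ := by
    intro b hb
    obtain ⟨ρ, hρ, hbρ⟩ := hEunb.2 _ (hΘ.succ_lt hb)
    exact ⟨ρ, hρ, (Order.lt_succ b).trans_le hbρ⟩
  set W : Set Ordinal.{0} := {o | ∃ ρ ∈ E, o ∈ C ρ} with hW
  have hWE : ∀ ρ ∈ E, W ∩ Iio ρ = C ρ := by
    intro ρ hρ
    ext o
    constructor
    · rintro ⟨⟨ρ', hρ', ho⟩, hoρ⟩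
      obtain e | rfl | e := lt_trichotomy ρ ρ'
      · rw [hEC ρ' hρ' ρ hρ e]
        exact ⟨ho, hoρ⟩
      · exact ho
      · rw [hEC ρ hρ ρ' hρ' e] at ho
        exact ho.1
    · exact fun ho => ⟨⟨ρ, hρ, ho⟩, (hC.unbounded ρ hρ.1 hρ.2.1).1 ho⟩
  have hWΘ : W ⊆ Iio κ.ord := by
    rintro o ⟨ρ, hρ, ho⟩
    exact lt_trans ((hC.unbounded ρ hρ.1 hρ.2.1).1 ho) hρ.1
  refine hC.nontrivial ⟨W, fun S hS hne hlt => ?_, ⟨hWΘ, fun b hb => ?_⟩, fun γ hγ hγΘ => ?_⟩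
  · obtain ⟨ρ, hρ, hlρ⟩ := hlimE _ hlt
    refine ⟨ρ, hρ, hC.closed ρ hρ.1 hρ.2.1 S (fun o ho => ?_) hne hlρ⟩
    rw [← hWE ρ hρ]
    exact ⟨hS ho, lt_of_le_of_lt (le_csSup ⟨κ.ord, fun x hx => (hWΘ (hS hx)).le⟩ ho) hlρ⟩
  · obtain ⟨ρ, hρ, hbρ⟩ := hlimE b hb
    obtain ⟨o, ho, hbo⟩ := (hC.unbounded ρ hρ.1 hρ.2.1).2 b hbρ
    exact ⟨o, ⟨ρ, hρ, ho⟩, hbo⟩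
  · obtain ⟨ρ, hρ, hγρ⟩ := hlimE γ hγΘ
    rw [← limitPts_inter_iff hγρ.le, hWE ρ hρ] at hγ
    rw [hC.coherent ρ hρ.1 hρ.2.1 γ hγ hγρ, ← hWE ρ hρ, inter_assoc, Iio_inter_Iio,
      inf_eq_right.2 hγρ.le]

theorem sInf_inter_diff {A : Set Ordinal.{0}} {a b : Ordinal.{0}}
    (h : ∃ y ∈ A, a ≤ y ∧ y < b) : sInf ((A ∩ Iio b) \ Iio a) = sInf (A \ Iio a) := by
  obtain ⟨y, hy, hay, hyb⟩ := h
  have hm : sInf (A \ Iio a) ∈ A \ Iio a := csInf_mem ⟨y, hy, not_lt.2 hay⟩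
  have hlt : sInf (A \ Iio a) < b := lt_of_le_of_lt (csInf_le' ⟨hy, not_lt.2 hay⟩) hyb
  exact le_antisymm (csInf_le' ⟨⟨hm.1, hlt⟩, hm.2⟩)
    (le_csInf ⟨y, ⟨hy, hyb⟩, not_lt.2 hay⟩ fun x hx => csInf_le' ⟨hx.1.1, hx.2⟩)

/-- Pigeonhole: if every `γ < Θ` is served by some `i`, then one `i` serves unboundedly many. -/
theorem exists_unbounded_of_forall_exists {Θ : Ordinal.{0}} (hδ : δ < Θ.cof)
    {P : Idx δ → Ordinal.{0} → Prop} (hP : ∀ γ < Θ, ∃ i, P i γ) :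
    ∃ i, ∀ b < Θ, ∃ γ < Θ, P i γ ∧ b ≤ γ := by
  by_contra! hcon
  choose b hb hbP using hcon
  obtain ⟨c, hc, hbc⟩ := exists_bound_Idx hδ b hb
  obtain ⟨i, hi⟩ := hP c hc
  exact absurd (hbP i c hc hi) (hbc i).not_gt

theorem exists_fresh_of_square (hU : IsNormalUltrafilter δ U) {l : Ordinal.{0}}
    (hl : Order.IsSuccLimit l) (hδ : δ < l.cof)
    (hν : ∀ᶠ i in (U : Filter (Idx δ)), (rep hU l i).cof = l.cof)
    {C : Ordinal.{0} → Set Ordinal.{0}} (hC : IsSquareSeq l.cof.ord C) :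
    ∃ A : Set Ordinal.{0}, UnbSub A l ∧ Fresh hU A := by
  have hκ := isRegular_cof hl
  have hω : ℵ₀ < l.cof := hU.uncountable.trans hδ
  obtain ⟨a, ha, hst⟩ := exists_stationary_fibers hκ hω hC
  set Θ := l.cof.ord with hΘ
  have hΘl : Order.IsSuccLimit Θ := isSuccLimit_ord hκ.aleph0_le
  have hΘc : δ < Θ.cof := by rwa [hΘ, hκ.cof_ord]
  let Z : Set Ordinal.{0} := {x | x < Θ ∧ StationaryIn (squareFiber C Θ a x) Θ}
  have hZ : #(Idx δ) ≤ #Z := by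
    rw [mk_idx]
    refine (Cardinal.lift_le.2 hΘc.le).trans
      (cof_le_mk hΘl (fun x : Z => x.1) (fun x => x.2.1) fun b hb => ?_)
    obtain ⟨x, hx, hbx, hs⟩ := hst b hb
    exact ⟨⟨x, hx, hs⟩, hbx⟩
  obtain ⟨ζ⟩ := hZ
  let L := squareLeft C Θ a ∅
  have hcoh : ∀ γ, ∀ β ∈ L γ, L β = L γ ∩ Iio β :=
    squareLeft_coherent hC.coherent fun _ _ _ _ _ _ _ h => h
  choose ξ hξ hcov using exists_enum (δ := δ) hU.uncountable.le (a := a) (B := ∅) hC.unbounded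
  let G : Idx δ → Set Ordinal.{0} := fun i => {γ | ¬ (γ < Θ ∧ Order.IsSuccLimit γ ∧ a < γ ∧
    ∃ j, i ≤ j ∧ sInf (C γ \ Iio a) = ζ j)}
  have hT : ∀ i, ∃ T, IsTree L (firstMembers ξ i) (G i) T := by
    refine fun i => exists_isTree squareLeft_subset (fun γ x hx => hx.1) hcoh ?_
    rintro γ hγ β ⟨hβγ, hβ⟩ ⟨-, hβl, haβ, j, hij, hj⟩
    obtain ⟨⟨hγl, hγΘ, -⟩, -, hβ⟩ := hβ.resolve_left (haβ.trans hβγ).not_ge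
    refine hγ ⟨hγΘ, hγl, haβ.trans hβγ, j, hij, ?_⟩
    rw [← hj, hC.coherent γ hγΘ hγl β hβ hβγ, sInf_inter_diff ((mem_limitPts_iff.1 hβ).2 a haβ)]
  choose T hT using hT
  have hG : ∀ γ < Θ, ∀ᶠ i in (U : Filter (Idx δ)), γ ∈ G i := by
    intro γ _
    by_cases h : ∃ j, sInf (C γ \ Iio a) = ζ j
    · obtain ⟨j, hj⟩ := h
      filter_upwards [eventually_lt_idx hU j] with i hi
      rintro ⟨-, -, -, k, hik, hk⟩
      obtain rfl := ζ.injective (Subtype.ext (hj.symm.trans hk))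
      exact absurd hik hi.not_ge
    · exact Filter.Eventually.of_forall fun i ⟨_, _, _, j, _, hj⟩ => h ⟨j, hj⟩
  obtain ⟨φ, hφ⟩ := exists_isCofinalFamily (rep hU l)
  have hsys : IsTreeSystem hU Θ l L (firstMembers ξ) G T fun γ i => φ i γ := by
    refine ⟨hΘl, hl, hT, ?_, fun γ hγ => ?_,
      fun γ hγ => eventually_mem_tree hU hT hG (fun γ hγ => hcov γ hγ (notMem_empty γ)) hγ,
      fun b hb => hφ.exists_const_le hδ hκ hν hb⟩
    · filter_upwards [hν] with i hi γ hγ β hβ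
      exact (hφ i).2.1 _ _ ((hT i).lt hβ) (by rwa [hi])
    · refine hφ.ordRank_lt (k := fun _ => γ) ?_
      filter_upwards [hν] with i hi
      rwa [hi]
  refine hsys.exists_fresh (x := univ) ?_
  rintro ⟨B, -, hB⟩
  obtain ⟨i, hi⟩ := exists_unbounded_of_forall_exists hΘc
    (P := fun i γ => (rep hU l i).cof = l.cof ∧ φ i γ ∈ B i ∧
      B i ∩ Iio (φ i γ) = treeSet (fun γ i => φ i γ) T univ γ i) fun γ hγ => by
    have h1 := hsys.branchSet_inter univ hγ
    rw [hB, ultSet_inter_Iio, ultSet_eq_iff] at h1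
    have h2 := (hsys.mem_branchSet_iff univ hγ).2 (mem_univ γ)
    rw [hB, ordRank_mem_ultSet] at h2
    exact (hν.and (h2.and h1)).exists
  choose! h hhΘ hh hle using hi
  have hchain : ∀ β < Θ, ∀ γ < Θ, h β < h γ → h β ∈ T i (h γ) := by
    intro β hβ γ hγ hlt
    obtain ⟨hcof, hm, -⟩ := hh β hβ
    have hφi : ∀ x y, x < y → y < Θ → φ i x < φ i y := fun x y hxy hy =>
      (hφ i).2.1 x y hxy (by rwa [hcof])
    have hmem : φ i (h β) ∈ B i ∩ Iio (φ i (h γ)) := ⟨hm, hφi _ _ hlt (hhΘ γ hγ)⟩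
    rw [(hh γ hγ).2.2] at hmem
    obtain ⟨x, ⟨hx, -⟩, e : φ i x = φ i (h β)⟩ := hmem
    obtain hlt' | rfl | hlt' := lt_trichotomy x (h β)
    · exact absurd e (hφi _ _ hlt' (hhΘ β hβ)).ne
    · exact hx
    · exact absurd e (hφi _ _ hlt' (((hT i).lt hx).trans (hhΘ γ hγ))).ne'
  have hclub := unbSub_closurePts hκ hω hhΘ
  obtain ⟨ρ, ⟨hρΘ, hρl, haρ, hρ⟩, -, -, hρh⟩ := (ζ i).2.2.2 _ (closedIn_closurePts Θ h) hclub
  refine absurd ((hT i).limit_mem_good (fun γ _ ρ hργ hρ => squareLeft_closed (hξ γ) hργ hρ)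
    hρl (hle ρ hρΘ) fun β hβ => ?_) fun hg => hg ⟨hρΘ, hρl, haρ, i, le_rfl, hρ⟩
  have hβΘ := hβ.trans hρΘ
  exact ⟨h β, hchain β hβΘ ρ hρΘ ((hρh β hβ).trans_le (hle ρ hρΘ)), hle β hβΘ, hρh β hβ⟩

/-- Assume: (a) the GCH holds at all cardinals `≥ δ`; (b) every regular
non-weakly-compact cardinal `κ > δ⁺` carries a `□(κ)`-sequence; (c) every singular
cardinal `κ > δ` carries a `□_κ`-sequence. Then for every limit ordinal `λ`, there is
an unbounded subset of `λ` fresh over `Ult(V,U)` if and only if `cof(λ)` is greater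
than `δ` and not weakly compact. -/
theorem stmt8 (δ : Cardinal.{0}) (U : Ultrafilter (Idx δ)) (hU : IsNormalUltrafilter δ U)
    (ha : ∀ ν : Cardinal.{0}, δ ≤ ν → (2 : Cardinal.{0}) ^ ν = Order.succ ν)
    (hb : ∀ κ : Cardinal.{0}, Order.succ δ < κ → κ.IsRegular → ¬ IsWeaklyCompact κ →
      ∃ C : Ordinal.{0} → Set Ordinal.{0}, IsSquareSeq κ.ord C)
    (hc : ∀ κ : Cardinal.{0}, δ < κ → IsSingular κ →
      ∃ C : Ordinal.{0} → Set Ordinal.{0}, IsSquareKappaSeq κ C)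
    (l : Ordinal.{0}) (hl : Order.IsSuccLimit l) :
    (∃ A : Set Ordinal.{0}, UnbSub A l ∧ Fresh hU A) ↔
      (δ < l.cof ∧ ¬ IsWeaklyCompact l.cof) := by
  refine ⟨fun ⟨A, hA, hf⟩ => cof_of_fresh hl hA hf, fun ⟨hδ, hwc⟩ => ?_⟩
  obtain hsucc | hsucc := (Order.succ_le_of_lt hδ).eq_or_lt
  · exact exists_fresh_of_cof_eq_succ hl hsucc.symm ha
  have hν : ∀ᶠ i in (U : Filter (Idx δ)), δ < (rep hU l i).cof := by
    by_contra h
    rw [← Ultrafilter.eventually_not] at h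
    have := cof_le_two_power hl le_rfl (h.mono fun i hi => not_lt.1 hi)
    rw [ha δ le_rfl] at this
    exact absurd hsucc this.not_gt
  by_cases hconst : ∃ κ, ∀ᶠ i in (U : Filter (Idx δ)), (rep hU l i).cof = κ
  · obtain ⟨κ, hκ⟩ := hconst
    obtain ⟨i, h1, h2⟩ := (hν.and hκ).exists
    obtain rfl := cof_eq_of_eventually hl (h2 ▸ h1) hκ
    obtain ⟨C, hC⟩ := hb _ hsucc (isRegular_cof hl) hwc
    exact exists_fresh_of_square hU hl hδ hκ hC
  · obtain ⟨μ, hδμ, hμ, hμl, hlμ, hlt, hgt⟩ :=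
      exists_singular_limit hl hν fun κ hκ => hconst ⟨κ, hκ⟩
    have hpow := ha μ hδμ.le
    obtain ⟨C, hC⟩ := hc μ hδμ hμ
    exact exists_fresh_of_singular hU hl hδμ
      ((hlμ.trans_eq hpow).antisymm (Order.succ_le_of_lt hμl)) hpow hlt hgt hC

end MU
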